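/- arXiv:2012.03336 — 3 statements merged into one kernel-verified Lean document; each statement's English description precedes it below -/
import Mathlib

section
/- Let L > 0 and n ∈ ℤ. For every x ∈ ℝ, the principal value H φ_n(x) = lim_{ε→0⁺} (1/π) ∫_{|x−y|>ε} φ_n(y)/(x−y) dy exists, and H φ_n(x) = −i · φ_n(x) if n ≥ 0, while H φ_n(x) = i · φ_n(x) if n ≤ −1. (With the sign convention σ(n) = 1 for n ≥ 0 and σ(n) = −1 for n ≤ −1, this says H φ_n = −i σ(n) φ_n.) -/
open MeasureTheory Filter

/-- Rational basis function `φ_n(x) = (L + ix)^n / (L - ix)^(n+1)`. -/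
noncomputable def ratBasis (L : ℝ) (n : ℤ) (x : ℝ) : ℂ :=
  ((L : ℂ) + Complex.I * x) ^ n / ((L : ℂ) - Complex.I * x) ^ (n + 1)

/-- The principal value Hilbert transform of a complex-valued function `f` at `x`
exists and equals `A`. -/
def HilbertPVC (f : ℝ → ℂ) (x : ℝ) (A : ℂ) : Prop :=
  Tendsto (fun ε : ℝ =>
      (1 / (Real.pi : ℂ)) * ∫ y in {y : ℝ | ε < |x - y|}, f y / ((x - y : ℝ) : ℂ))
    (nhdsWithin 0 (Set.Ioi 0)) (nhds A)

/-- Fundamental theorem of calculus on the complement of a closed interval around `x`. -/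
theorem setIntegral_abs_sub_gt_of_hasDerivAt {F f : ℝ → ℂ} {x ε : ℝ} {a b : ℂ} (hε : 0 < ε)
    (hF : ∀ y, y ≠ x → HasDerivAt F (f y) y)
    (hf : IntegrableOn f {y : ℝ | ε < |x - y|})
    (ha : Tendsto F atBot (nhds a)) (hb : Tendsto F atTop (nhds b)) :
    ∫ y in {y : ℝ | ε < |x - y|}, f y = (F (x - ε) - F (x + ε)) + (b - a) := by
  have hset : {y : ℝ | ε < |x - y|} = Set.Iio (x - ε) ∪ Set.Ioi (x + ε) := by
    ext y
    simp only [Set.mem_ofPred_eq, Set.mem_union, Set.mem_Iio, Set.mem_Ioi, lt_abs]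
    constructor <;> rintro (h | h)
    · left; linarith
    · right; linarith
    · left; linarith
    · right; linarith
  rw [hset] at hf ⊢
  have hl := hf.mono_set Set.subset_union_left
  have hr := hf.mono_set Set.subset_union_right
  have hdisj : Disjoint (Set.Iio (x - ε)) (Set.Ioi (x + ε)) :=
    Set.disjoint_left.mpr fun y h1 h2 => by
      simp only [Set.mem_Iio, Set.mem_Ioi] at h1 h2
      linarith
  rw [setIntegral_union hdisj measurableSet_Ioi hl hr, ← integral_Iic_eq_integral_Iio,
    integral_Iic_of_hasDerivAt_of_tendsto' (f := F) (m := a)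
      (fun y hy => hF y (by simp only [Set.mem_Iic] at hy; linarith))
      ((integrableOn_Iic_iff_integrableOn_Iio).mpr hl) ha,
    integral_Ioi_of_hasDerivAt_of_tendsto' (f := F) (m := b)
      (fun y hy => hF y (by simp only [Set.mem_Ici] at hy; linarith)) hr hb]
  ring

theorem sub_I_mul_ne_zero {L : ℝ} (hL : 0 < L) (y : ℝ) : (L : ℂ) - Complex.I * y ≠ 0 := by
  intro h
  have := congrArg Complex.re h
  simp at this
  exact hL.ne' this

theorem add_I_mul_ne_zero {L : ℝ} (hL : 0 < L) (y : ℝ) : (L : ℂ) + Complex.I * y ≠ 0 := by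
  intro h
  have := congrArg Complex.re h
  simp at this
  exact hL.ne' this

theorem conj_add_I_mul (L y : ℝ) :
    (starRingEnd ℂ) ((L : ℂ) + Complex.I * y) = (L : ℂ) - Complex.I * y := by
  simp [sub_eq_add_neg]

theorem conj_sub_I_mul (L y : ℝ) :
    (starRingEnd ℂ) ((L : ℂ) - Complex.I * y) = (L : ℂ) + Complex.I * y := by
  simp

theorem norm_sq_sub_I_mul (L y : ℝ) : ‖(L : ℂ) - Complex.I * y‖ ^ 2 = L ^ 2 + y ^ 2 := by
  rw [← Complex.normSq_eq_norm_sq, Complex.normSq_apply]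
  simp
  ring

theorem norm_ratBasis {L : ℝ} (hL : 0 < L) (n : ℤ) (y : ℝ) :
    ‖ratBasis L n y‖ = ‖(L : ℂ) - Complex.I * y‖⁻¹ := by
  have h : ‖(L : ℂ) + Complex.I * y‖ = ‖(L : ℂ) - Complex.I * y‖ := by
    rw [← conj_add_I_mul, Complex.norm_conj]
  have h0 : ‖(L : ℂ) - Complex.I * y‖ ≠ 0 := norm_ne_zero_iff.mpr (sub_I_mul_ne_zero hL y)
  rw [ratBasis, norm_div, norm_zpow, norm_zpow, h, zpow_add_one₀ h0]
  field_simp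

theorem continuous_ratBasis {L : ℝ} (hL : 0 < L) (n : ℤ) : Continuous (ratBasis L n) := by
  unfold ratBasis
  refine Continuous.div ?_ ?_ fun y => zpow_ne_zero _ (sub_I_mul_ne_zero hL y)
  · exact Continuous.zpow₀ (by fun_prop) _ fun y => Or.inl (add_I_mul_ne_zero hL y)
  · exact Continuous.zpow₀ (by fun_prop) _ fun y => Or.inl (sub_I_mul_ne_zero hL y)

theorem ratBasis_add_one {L : ℝ} (hL : 0 < L) (n : ℤ) (y : ℝ) :
    ratBasis L (n + 1) y =
      ratBasis L n y * (((L : ℂ) + Complex.I * y) / ((L : ℂ) - Complex.I * y)) := by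
  rw [ratBasis, ratBasis, zpow_add_one₀ (add_I_mul_ne_zero hL y),
    zpow_add_one₀ (sub_I_mul_ne_zero hL y) (n + 1), mul_div_mul_comm]

theorem conj_ratBasis (L : ℝ) (n : ℤ) (y : ℝ) :
    (starRingEnd ℂ) (ratBasis L n y) = ratBasis L (-n - 1) y := by
  rw [ratBasis, ratBasis, map_div₀, map_zpow₀, map_zpow₀, conj_add_I_mul, conj_sub_I_mul,
    show -n - 1 = -(n + 1) by ring, show -(n + 1) + 1 = -n by ring, zpow_neg, zpow_neg,
    div_inv_eq_mul, div_eq_mul_inv, mul_comm]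

theorem integrable_inv_sq_add_sq {L : ℝ} (hL : 0 < L) :
    Integrable fun y : ℝ => (L ^ 2 + y ^ 2)⁻¹ := by
  have h := (integrable_inv_one_add_sq.comp_div hL.ne').const_mul (L ^ 2)⁻¹
  refine h.congr (Eventually.of_forall fun y => ?_)
  have : 0 < L ^ 2 + y ^ 2 := by positivity
  simp only
  rw [← mul_inv]
  congr 1
  field_simp

theorem integrable_ratBasis_div {L : ℝ} (hL : 0 < L) (n : ℤ) :
    Integrable fun y : ℝ => ratBasis L n y / ((L : ℂ) - Complex.I * y) := by
  refine (integrable_inv_sq_add_sq hL).mono' ?_ (Eventually.of_forall fun y => ?_)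
  · exact ((continuous_ratBasis hL n).div (by fun_prop)
      fun y => sub_I_mul_ne_zero hL y).aestronglyMeasurable
  · rw [norm_div, norm_ratBasis hL, ← norm_sq_sub_I_mul, div_eq_mul_inv, ← mul_inv, ← sq]

theorem integrableOn_ratBasis_div_sub {L : ℝ} (hL : 0 < L) (n : ℤ) (x : ℝ) {ε : ℝ} (hε : 0 < ε) :
    IntegrableOn (fun y : ℝ => ratBasis L n y / ((x - y : ℝ) : ℂ)) {y : ℝ | ε < |x - y|} := by
  have hS : MeasurableSet {y : ℝ | ε < |x - y|} :=
    measurableSet_lt measurable_const (by fun_prop)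
  set C := 1 + (L + |x|) / ε with hC
  have hC0 : 0 < C := by positivity
  refine (((integrable_inv_sq_add_sq hL).const_mul C).integrableOn).mono' ?_ ?_
  · exact ((continuous_ratBasis hL n).measurable.div (by fun_prop)).aestronglyMeasurable
  · refine (ae_restrict_iff' hS).mpr (Eventually.of_forall fun y hy => ?_)
    have hy : ε < |x - y| := hy
    have hpos : 0 < |x - y| := hε.trans hy
    have hN : 0 < ‖(L : ℂ) - Complex.I * y‖ := norm_pos_iff.mpr (sub_I_mul_ne_zero hL y)
    have hle : ‖(L : ℂ) - Complex.I * y‖ ≤ C * |x - y| := by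
      have h1 : ‖(L : ℂ) - Complex.I * y‖ ≤ L + |y| := by
        refine (norm_sub_le _ _).trans (le_of_eq ?_)
        simp [abs_of_pos hL]
      have h2 : |y| ≤ |x| + |x - y| := by
        have := abs_sub x (x - y)
        simpa using this
      have h3 : L + |x| ≤ (L + |x|) / ε * |x - y| := by
        rw [div_mul_eq_mul_div, le_div_iff₀ hε]
        exact mul_le_mul_of_nonneg_left hy.le (by positivity)
      rw [hC]
      linarith
    rw [norm_div, norm_ratBasis hL, ← norm_sq_sub_I_mul, Complex.norm_real, Real.norm_eq_abs,
      div_eq_mul_inv, sq, mul_inv, mul_left_comm]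
    refine mul_le_mul_of_nonneg_left ?_ (by positivity)
    rw [← div_eq_mul_inv, inv_le_comm₀ hpos (by positivity), inv_div, div_le_iff₀ hC0]
    linarith

theorem tendsto_cayley {L : ℝ} (hL : 0 < L) {l : Filter ℝ} (hl : Tendsto (fun y => |y|) l atTop) :
    Tendsto (fun y : ℝ => ((L : ℂ) + Complex.I * y) / ((L : ℂ) - Complex.I * y)) l
      (nhds (-1)) := by
  have h1 : Tendsto (fun y : ℝ => (L : ℂ) - Complex.I * y) l (Bornology.cobounded ℂ) := by
    rw [← tendsto_norm_atTop_iff_cobounded]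
    refine tendsto_atTop_mono (fun y => ?_) hl
    simpa using Complex.abs_im_le_norm ((L : ℂ) - Complex.I * y)
  have h2 := ((tendsto_inv₀_cobounded.comp h1).const_mul (2 * L : ℂ)).const_add (-1)
  rw [mul_zero, add_zero] at h2
  refine h2.congr fun y => ?_
  have := sub_I_mul_ne_zero hL y
  simp only [Function.comp_apply]
  field_simp
  ring

theorem hasDerivAt_cayley_pow {L : ℝ} (hL : 0 < L) (n : ℕ) (y : ℝ) :
    HasDerivAt (fun y : ℝ =>
        (((L : ℂ) + Complex.I * y) / ((L : ℂ) - Complex.I * y)) ^ (n + 1) /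
          ((n + 1) * (2 * L * Complex.I)))
      (ratBasis L n y / ((L : ℂ) - Complex.I * y)) y := by
  have h0 := sub_I_mul_ne_zero hL y
  have hid : HasDerivAt (fun y : ℝ => Complex.I * (y : ℂ)) Complex.I y := by
    simpa using (Complex.ofRealCLM.hasDerivAt (x := y)).const_mul Complex.I
  have h := ((hid.const_add (L : ℂ)).div (hid.const_sub (L : ℂ)) h0).pow (n + 1) |>.div_const
    (((n : ℂ) + 1) * (2 * L * Complex.I))
  refine h.congr_deriv ?_
  have hn : (n : ℂ) + 1 ≠ 0 := by exact_mod_cast n.succ_ne_zero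
  have hLc : (L : ℂ) ≠ 0 := by exact_mod_cast hL.ne'
  have hr : ratBasis L n y = ((L : ℂ) + Complex.I * y) ^ n / ((L : ℂ) - Complex.I * y) ^ (n + 1) := by
    rw [ratBasis]; norm_cast
  rw [hr]
  simp only [Pi.div_apply, Nat.cast_add, Nat.cast_one, Nat.add_sub_cancel, div_pow]
  field_simp
  ring

/-- The part of the integral of `φ_n / (L - i y)` away from `x` vanishes in the limit. -/
theorem tendsto_setIntegral_ratBasis_div {L : ℝ} (hL : 0 < L) (n : ℕ) (x : ℝ) :
    Tendsto (fun ε : ℝ =>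
        ∫ y in {y : ℝ | ε < |x - y|}, ratBasis L n y / ((L : ℂ) - Complex.I * y))
      (nhdsWithin 0 (Set.Ioi 0)) (nhds 0) := by
  set F : ℝ → ℂ := fun y : ℝ =>
    (((L : ℂ) + Complex.I * y) / ((L : ℂ) - Complex.I * y)) ^ (n + 1) /
      ((n + 1) * (2 * L * Complex.I)) with hF
  have hlim : ∀ l : Filter ℝ, Tendsto (fun y => |y|) l atTop →
      Tendsto F l (nhds ((-1) ^ (n + 1) / ((n + 1) * (2 * L * Complex.I)))) :=
    fun l hl => ((tendsto_cayley hL hl).pow (n + 1)).div_const _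
  have hcont : Continuous F :=
    continuous_iff_continuousAt.mpr fun y => (hasDerivAt_cayley_pow hL n y).continuousAt
  have hT : Tendsto (fun ε : ℝ => F (x - ε) - F (x + ε)) (nhdsWithin 0 (Set.Ioi 0)) (nhds 0) := by
    have : Continuous fun ε : ℝ => F (x - ε) - F (x + ε) := by fun_prop
    simpa using (this.tendsto 0).mono_left nhdsWithin_le_nhds
  refine hT.congr' ?_
  filter_upwards [self_mem_nhdsWithin] with ε hε
  rw [setIntegral_abs_sub_gt_of_hasDerivAt hε (fun y _ => hasDerivAt_cayley_pow hL n y)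
    (integrable_ratBasis_div hL n).integrableOn (hlim _ tendsto_abs_atBot_atTop)
    (hlim _ tendsto_abs_atTop_atTop)]
  simp [hF]

theorem tendsto_log_ratio (L x : ℝ) {l : Filter ℝ} (hl : Tendsto (fun y : ℝ => (y - x)⁻¹) l (nhds 0))
    (hx : ∀ᶠ y in l, y ≠ x) :
    Tendsto (fun y : ℝ => Real.log ((L ^ 2 + y ^ 2) / (y - x) ^ 2)) l (nhds 0) := by
  have h : Tendsto (fun y : ℝ => (L ^ 2 + y ^ 2) / (y - x) ^ 2) l (nhds 1) := by
    have := ((hl.const_mul (2 * x)).const_add 1).add ((hl.pow 2).const_mul (L ^ 2 + x ^ 2))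
    simp only [mul_zero, add_zero, ne_eq, OfNat.ofNat_ne_zero, not_false_eq_true, zero_pow] at this
    refine this.congr' ?_
    filter_upwards [hx] with y hy
    have := sub_ne_zero.mpr hy
    field_simp
    ring
  simpa using h.log one_ne_zero

theorem hasDerivAt_ratBasis_zero_primitive {L : ℝ} (hL : 0 < L) {x y : ℝ} (hy : y ≠ x) :
    HasDerivAt (fun y : ℝ => ((L : ℂ) - Complex.I * x)⁻¹ *
        (((1 / 2 * Real.log ((L ^ 2 + y ^ 2) / (y - x) ^ 2) : ℝ) : ℂ) -
          Complex.I * ((Real.arctan (y / L) : ℝ) : ℂ)))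
      (ratBasis L 0 y / ((x - y : ℝ) : ℂ)) y := by
  have hyx := sub_ne_zero.mpr hy
  have hpos : L ^ 2 + y ^ 2 ≠ 0 := by positivity
  have hlog : HasDerivAt (fun y : ℝ => 1 / 2 * Real.log ((L ^ 2 + y ^ 2) / (y - x) ^ 2))
      (y / (L ^ 2 + y ^ 2) - 1 / (y - x)) y := by
    have hnum : HasDerivAt (fun y : ℝ => L ^ 2 + y ^ 2) (2 * y) y := by
      simpa using ((hasDerivAt_id y).pow 2).const_add (L ^ 2)
    have hden : HasDerivAt (fun y : ℝ => (y - x) ^ 2) (2 * (y - x)) y := by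
      exact (((hasDerivAt_id y).sub_const x).pow 2).congr_deriv (by simp)
    refine (((hnum.div hden (pow_ne_zero 2 hyx)).log
      (div_ne_zero hpos (pow_ne_zero 2 hyx))).const_mul (1 / 2)).congr_deriv ?_
    simp only [Pi.div_apply]
    field_simp
  have harc : HasDerivAt (fun y : ℝ => Real.arctan (y / L)) (L / (L ^ 2 + y ^ 2)) y := by
    refine (((hasDerivAt_id y).div_const L).arctan).congr_deriv ?_
    have : 1 + (y / L) ^ 2 ≠ 0 := by positivity
    simp only [id]
    field_simp
  refine ((hlog.ofReal_comp.sub (harc.ofReal_comp.const_mul Complex.I)).const_mul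
    ((L : ℂ) - Complex.I * x)⁻¹).congr_deriv ?_
  have h1 := sub_I_mul_ne_zero hL x
  have h2 := sub_I_mul_ne_zero hL y
  have h3 := add_I_mul_ne_zero hL y
  have h4 : (y : ℂ) - x ≠ 0 := by exact_mod_cast hyx
  have h5 : (L : ℂ) ^ 2 + (y : ℂ) ^ 2 = (L + Complex.I * y) * (L - Complex.I * y) := by
    linear_combination (y : ℂ) ^ 2 * Complex.I_sq
  have h6 : (x : ℂ) - y = -(y - x) := by ring
  simp only [ratBasis, zero_add]
  push_cast
  rw [h5, h6, zpow_zero, zpow_one]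
  field_simp
  linear_combination ((y : ℂ) * (y - x)) * Complex.I_sq

theorem hilbertPVC_ratBasis_zero {L : ℝ} (hL : 0 < L) (x : ℝ) :
    HilbertPVC (ratBasis L 0) x (-Complex.I * ratBasis L 0 x) := by
  set c := ((L : ℂ) - Complex.I * x)⁻¹ with hc
  set F : ℝ → ℂ := fun y : ℝ => c *
    (((1 / 2 * Real.log ((L ^ 2 + y ^ 2) / (y - x) ^ 2) : ℝ) : ℂ) -
      Complex.I * ((Real.arctan (y / L) : ℝ) : ℂ)) with hF
  have hlim : ∀ (l : Filter ℝ) (a : ℝ), Tendsto (fun y : ℝ => (y - x)⁻¹) l (nhds 0) →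
      (∀ᶠ y in l, y ≠ x) → Tendsto (fun y : ℝ => Real.arctan (y / L)) l (nhds a) →
      Tendsto F l (nhds (c * (-Complex.I * a))) := by
    intro l a h1 h2 h3
    have h := ((((tendsto_log_ratio L x h1 h2).const_mul (1 / 2)).ofReal).sub
      (h3.ofReal.const_mul Complex.I)).const_mul c
    simpa only [hF, mul_zero, Complex.ofReal_zero, zero_sub, neg_mul] using h
  have hbot : Tendsto F atBot (nhds (c * (-Complex.I * ((-(Real.pi / 2) : ℝ) : ℂ)))) := by
    refine hlim _ _ ?_ (eventually_ne_atBot x) ?_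
    · exact tendsto_inv_atBot_zero.comp (tendsto_atBot_add_const_right _ (-x) tendsto_id)
    · exact (Real.tendsto_arctan_atBot.mono_right nhdsWithin_le_nhds).comp
        (tendsto_id.atBot_div_const hL)
  have htop : Tendsto F atTop (nhds (c * (-Complex.I * ((Real.pi / 2 : ℝ) : ℂ)))) := by
    refine hlim _ _ ?_ (eventually_ne_atTop x) ?_
    · exact tendsto_inv_atTop_zero.comp (tendsto_atTop_add_const_right _ (-x) tendsto_id)
    · exact (Real.tendsto_arctan_atTop.mono_right nhdsWithin_le_nhds).comp
        (tendsto_id.atTop_div_const hL)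
  -- `F` without the logarithmic singularity, which cancels between `x - ε` and `x + ε`
  set G : ℝ → ℂ := fun y : ℝ => c *
    (((1 / 2 * Real.log (L ^ 2 + y ^ 2) : ℝ) : ℂ) -
      Complex.I * ((Real.arctan (y / L) : ℝ) : ℂ)) with hG
  have hGc : Continuous G := by
    have h1 : Continuous fun y : ℝ => Real.log (L ^ 2 + y ^ 2) :=
      Continuous.log (by fun_prop) fun y => by positivity
    have h2 : Continuous fun y : ℝ => Real.arctan (y / L) :=
      Real.continuous_arctan.comp (by fun_prop)
    fun_prop
  have hT : Tendsto (fun ε : ℝ => (1 / (Real.pi : ℂ)) *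
      ((G (x - ε) - G (x + ε)) + c * (-Complex.I * Real.pi)))
      (nhdsWithin 0 (Set.Ioi 0)) (nhds (-Complex.I * ratBasis L 0 x)) := by
    have h : Continuous fun ε : ℝ => (1 / (Real.pi : ℂ)) *
      ((G (x - ε) - G (x + ε)) + c * (-Complex.I * Real.pi)) := by fun_prop
    have h' := (h.tendsto 0).mono_left (nhdsWithin_le_nhds (s := Set.Ioi 0))
    convert h' using 2
    have hpi : (Real.pi : ℂ) ≠ 0 := by exact_mod_cast Real.pi_ne_zero
    have h0 := sub_I_mul_ne_zero hL x
    simp only [ratBasis, hc, sub_zero, add_zero, sub_self, zero_add, zpow_zero, zpow_one]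
    field_simp
  refine hT.congr' ?_
  filter_upwards [self_mem_nhdsWithin] with ε hε
  have hε : 0 < ε := hε
  rw [setIntegral_abs_sub_gt_of_hasDerivAt hε
    (fun y hy => hasDerivAt_ratBasis_zero_primitive hL hy)
    (integrableOn_ratBasis_div_sub hL 0 x hε) hbot htop]
  have hlog : ∀ y : ℝ, (y - x) ^ 2 = ε ^ 2 → Real.log ((L ^ 2 + y ^ 2) / (y - x) ^ 2) =
      Real.log (L ^ 2 + y ^ 2) - Real.log (ε ^ 2) := fun y hy => by
    rw [hy, Real.log_div (by positivity) (by positivity)]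
  rw [hlog (x - ε) (by ring), hlog (x + ε) (by ring)]
  simp only [hG]
  push_cast
  ring

theorem HilbertPVC.ratBasis_add_one {L : ℝ} (hL : 0 < L) {n : ℕ} {x : ℝ} {c : ℂ}
    (h : HilbertPVC (ratBasis L n) x (c * ratBasis L n x)) :
    HilbertPVC (ratBasis L (n + 1)) x (c * ratBasis L (n + 1) x) := by
  set w := ((L : ℂ) + Complex.I * x) / ((L : ℂ) - Complex.I * x) with hw
  set d := 2 * L * Complex.I / ((L : ℂ) - Complex.I * x) with hd
  have hT := (Tendsto.const_mul w h).sub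
    ((tendsto_setIntegral_ratBasis_div hL n x).const_mul (1 / (Real.pi : ℂ) * d))
  rw [mul_zero, sub_zero, mul_left_comm, mul_comm w, hw, ← _root_.ratBasis_add_one hL] at hT
  refine hT.congr' ?_
  filter_upwards [self_mem_nhdsWithin] with ε hε
  have hε : 0 < ε := hε
  have hS : MeasurableSet {y : ℝ | ε < |x - y|} :=
    measurableSet_lt measurable_const (by fun_prop)
  have hint : ∫ y in {y : ℝ | ε < |x - y|}, ratBasis L (n + 1) y / ((x - y : ℝ) : ℂ) =
      w * (∫ y in {y : ℝ | ε < |x - y|}, ratBasis L n y / ((x - y : ℝ) : ℂ)) -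
        d * ∫ y in {y : ℝ | ε < |x - y|}, ratBasis L n y / ((L : ℂ) - Complex.I * y) := by
    rw [← integral_const_mul, ← integral_const_mul, ← integral_sub
      ((integrableOn_ratBasis_div_sub hL n x hε).const_mul w)
      ((integrable_ratBasis_div hL n).integrableOn.const_mul d)]
    refine setIntegral_congr_fun hS fun y hy => ?_
    have hxy : (x : ℂ) - y ≠ 0 := by
      have : x - y ≠ 0 := abs_pos.mp (hε.trans hy)
      exact_mod_cast this
    have h1 := sub_I_mul_ne_zero hL x
    have h2 := sub_I_mul_ne_zero hL y
    simp only [_root_.ratBasis_add_one hL, hw, hd]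
    push_cast
    field_simp
    ring
  rw [hint, hw]
  ring

theorem HilbertPVC.conj {f : ℝ → ℂ} {x : ℝ} {A : ℂ} (h : HilbertPVC f x A) :
    HilbertPVC (fun y => (starRingEnd ℂ) (f y)) x ((starRingEnd ℂ) A) := by
  refine ((Complex.continuous_conj.tendsto A).comp h).congr fun ε => ?_
  simp only [Function.comp_apply, map_mul, map_div₀, map_one, Complex.conj_ofReal,
    ← integral_conj]

theorem hilbertPVC_ratBasis_natCast {L : ℝ} (hL : 0 < L) (n : ℕ) (x : ℝ) :
    HilbertPVC (ratBasis L n) x (-Complex.I * ratBasis L n x) := by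
  induction n with
  | zero => exact hilbertPVC_ratBasis_zero hL x
  | succ n ih => exact_mod_cast ih.ratBasis_add_one hL

/-- `H φ_n = -i φ_n` for `n ≥ 0` and `H φ_n = i φ_n` for `n ≤ -1`. -/
theorem hilbert_ratBasis (L : ℝ) (hL : 0 < L) (n : ℤ) (x : ℝ) :
    (0 ≤ n → HilbertPVC (ratBasis L n) x (-Complex.I * ratBasis L n x)) ∧
    (n ≤ -1 → HilbertPVC (ratBasis L n) x (Complex.I * ratBasis L n x)) := by
  constructor
  · intro hn
    lift n to ℕ using hn
    exact hilbertPVC_ratBasis_natCast hL n x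
  · intro hn
    obtain ⟨m, hm⟩ := Int.eq_ofNat_of_zero_le (show 0 ≤ -n - 1 by lia)
    obtain rfl : n = -(m : ℤ) - 1 := by lia
    simpa [conj_ratBasis L] using (hilbertPVC_ratBasis_natCast hL m x).conj
end

section
/- Conservation of energy for the gBO equation: let m ≥ 2 be an integer and let u(x,t) be such that t ↦ u(·,t) is a continuously differentiable curve in the Schwartz space 𝒮(ℝ, ℝ), and suppose that for every (x,t) the principal value H(∂_x² u(·,t))(x) exists and ∂_t u(x,t) = H(∂_x² u(·,t))(x) − u(x,t)^{m−1} ∂_x u(x,t). Then the energy E[u(t)] = (1/2) ∫_ℝ u(x,t) · H(∂_x u(·,t))(x) dx − (1/(m(m+1))) ∫_ℝ u(x,t)^{m+1} dx is independent of t. -/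
open MeasureTheory Filter

/-- The principal value Hilbert transform of `f : ℝ → ℝ` at `x` exists and equals `A`. -/
def HilbertPVR (f : ℝ → ℝ) (x A : ℝ) : Prop :=
  Tendsto (fun ε : ℝ =>
      (1 / Real.pi) * ∫ y in {y : ℝ | ε < |x - y|}, f y / (x - y))
    (nhdsWithin 0 (Set.Ioi 0)) (nhds A)

/-- A continuous seminorm controlling the decay of a Schwartz function to third order. -/
noncomputable def decayNorm (f : SchwartzMap ℝ ℝ) : ℝ :=
  2 ^ 3 * (Finset.Iic ((3, 0) : ℕ × ℕ)).sup (fun m => SchwartzMap.seminorm ℝ m.1 m.2) f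

/-- The derivative as an operation on Schwartz functions. -/
noncomputable abbrev schwartzDeriv (f : SchwartzMap ℝ ℝ) : SchwartzMap ℝ ℝ :=
  SchwartzMap.derivCLM ℝ ℝ f

/-- Convolution with the logarithm. -/
noncomputable def logConv (f : ℝ → ℝ) (x : ℝ) : ℝ := ∫ z, Real.log z * f (x - z)

lemma hasDerivAt_schwartz (f : SchwartzMap ℝ ℝ) (x : ℝ) :
    HasDerivAt f (schwartzDeriv f x) x := f.hasDerivAt x

lemma abs_mul_le_decayNorm (f : SchwartzMap ℝ ℝ) (x : ℝ) :
    (1 + |x|) ^ 3 * |f x| ≤ decayNorm f := by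
  have := SchwartzMap.one_add_le_sup_seminorm_apply (𝕜 := ℝ) (m := (3, 0)) (k := 3) (n := 0)
    le_rfl le_rfl f x
  simpa [decayNorm] using this

lemma decayNorm_nonneg (f : SchwartzMap ℝ ℝ) : 0 ≤ decayNorm f :=
  le_trans (by positivity) (abs_mul_le_decayNorm f 0)

lemma abs_le_decayNorm_mul (f : SchwartzMap ℝ ℝ) (x : ℝ) :
    |f x| ≤ decayNorm f * ((1 + |x|) ^ 3)⁻¹ := by
  rw [← div_eq_mul_inv, le_div_iff₀ (by positivity), mul_comm]
  exact abs_mul_le_decayNorm f x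

lemma abs_le_decayNorm (f : SchwartzMap ℝ ℝ) (x : ℝ) : |f x| ≤ decayNorm f := by
  have h1 : (1 : ℝ) ≤ (1 + |x|) ^ 3 := one_le_pow₀ (by linarith [abs_nonneg x])
  nlinarith [abs_mul_le_decayNorm f x, abs_nonneg (f x)]

lemma continuous_decayNorm : Continuous decayNorm := by
  have hs : Continuous (⇑(∑ i ∈ Finset.Iic ((3, 0) : ℕ × ℕ),
      schwartzSeminormFamily ℝ ℝ ℝ i)) := by
    refine Finset.sum_induction _ (fun p : Seminorm ℝ (SchwartzMap ℝ ℝ) => Continuous p)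
      (fun p q hp hq => hp.add hq) continuous_const fun i _ =>
        (schwartz_withSeminorms ℝ ℝ ℝ).continuous_seminorm i
  exact continuous_const.mul (Seminorm.continuous_of_le hs (Seminorm.finset_sup_le_sum _ _))

lemma integrable_inv_one_add_abs_sq : Integrable (fun x : ℝ => ((1 + |x|) ^ 2)⁻¹) := by
  refine integrable_inv_one_add_sq.mono' (by fun_prop) (.of_forall fun x => ?_)
  rw [Real.norm_of_nonneg (by positivity)]
  gcongr
  nlinarith [abs_nonneg x, sq_abs x]

lemma abs_mul_inv_one_add_abs_cube_le (x : ℝ) :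
    |x| * ((1 + |x|) ^ 3)⁻¹ ≤ ((1 + |x|) ^ 2)⁻¹ := by
  have : 0 < 1 + |x| := by positivity
  rw [← div_eq_mul_inv, div_le_iff₀ (by positivity), pow_succ (1 + |x|) 2, ← mul_assoc,
    inv_mul_cancel₀ (by positivity)]
  linarith

lemma integrable_inv_one_add_abs_cube : Integrable (fun x : ℝ => ((1 + |x|) ^ 3)⁻¹) := by
  refine integrable_inv_one_add_abs_sq.mono' (by fun_prop) (.of_forall fun x => ?_)
  rw [Real.norm_of_nonneg (by positivity)]
  gcongr
  · linarith [abs_nonneg x]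
  · norm_num

lemma integrable_posLog_inv : Integrable (fun x : ℝ => Real.posLog x⁻¹) := by
  have h : IntegrableOn Real.log (Set.Ioc (-1) 1) := by
    rw [← intervalIntegrable_iff_integrableOn_Ioc_of_le (by norm_num)]
    exact intervalIntegral.intervalIntegrable_log'
  have h2 : Integrable ((Set.Ioc (-1) 1).indicator fun x => ‖Real.log x‖) :=
    (integrable_indicator_iff measurableSet_Ioc).2 h.norm
  refine h2.mono' ?_ ?_
  · exact (Real.continuous_posLog.measurable.comp measurable_inv).aestronglyMeasurable
  · have hne : ∀ᵐ x : ℝ, x ≠ -1 := by simp [ae_iff]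
    filter_upwards [hne] with x hx
    rw [Real.norm_of_nonneg Real.posLog_nonneg]
    by_cases hx1 : x ∈ Set.Ioc (-1 : ℝ) 1
    · rw [Set.indicator_of_mem hx1, Real.posLog_apply, Real.log_inv]
      exact max_le (norm_nonneg _) (by simpa using neg_le_abs (Real.log x))
    · rw [Set.indicator_of_notMem hx1]
      apply le_of_eq
      rw [Real.posLog_eq_zero_iff, abs_inv]
      apply inv_le_one_of_one_le₀
      by_contra! hc
      rw [abs_lt] at hc
      exact hx1 ⟨hc.1, hc.2.le⟩

lemma posLog_le_abs (x : ℝ) : Real.posLog x ≤ |x| := by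
  rw [Real.posLog_apply]
  exact max_le (abs_nonneg x) (by rw [← Real.log_abs]; exact Real.log_le_self (abs_nonneg x))

lemma abs_log_le (x : ℝ) : |Real.log x| ≤ Real.posLog x⁻¹ + |x| := by
  rw [← Real.posLog_sub_posLog_inv, abs_le]
  have h1 : 0 ≤ Real.posLog x := Real.posLog_nonneg
  have h2 : 0 ≤ Real.posLog x⁻¹ := Real.posLog_nonneg
  constructor <;> linarith [posLog_le_abs x, abs_nonneg x]

lemma posLog_sub_posLog_le (x y : ℝ) : Real.posLog x - Real.posLog y ≤ |x - y| := by
  rw [← Real.posLog_abs x, ← Real.posLog_abs y, Real.posLog_eq_log_max_one (abs_nonneg x),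
    Real.posLog_eq_log_max_one (abs_nonneg y)]
  have hx : 1 ≤ max 1 |x| := le_max_left _ _
  have hy : 1 ≤ max 1 |y| := le_max_left _ _
  rw [← Real.log_div (by linarith) (by linarith)]
  have hxy : |x| ≤ |y| + |x - y| := by linarith [abs_sub_abs_le_abs_sub x y]
  have hmax : max 1 |x| ≤ max 1 |y| + |x - y| :=
    max_le (by linarith [abs_nonneg (x - y)]) (by linarith [le_max_right 1 |y|])
  refine (Real.log_le_sub_one_of_pos (by positivity)).trans ?_
  rw [sub_le_iff_le_add, div_le_iff₀ (by linarith)]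
  nlinarith [abs_nonneg (x - y)]

lemma abs_posLog_sub_posLog_le (x y : ℝ) : |Real.posLog x - Real.posLog y| ≤ |x - y| := by
  rw [abs_le]
  have := posLog_sub_posLog_le y x
  rw [abs_sub_comm] at this
  exact ⟨by linarith, posLog_sub_posLog_le x y⟩

lemma integrable_log_mul_inv_one_add_abs_cube :
    Integrable (fun x : ℝ => |Real.log x| * ((1 + |x|) ^ 3)⁻¹) := by
  refine (integrable_posLog_inv.add integrable_inv_one_add_abs_sq).mono' (by fun_prop)
    (.of_forall fun x => ?_)
  rw [Real.norm_of_nonneg (by positivity), Pi.add_apply]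
  have h1 : ((1 + |x|) ^ 3)⁻¹ ≤ 1 :=
    inv_le_one_of_one_le₀ (one_le_pow₀ (by linarith [abs_nonneg x]))
  have h2 : 0 ≤ ((1 + |x|) ^ 3)⁻¹ := by positivity
  have h3 : 0 ≤ Real.posLog x⁻¹ := Real.posLog_nonneg
  nlinarith [abs_mul_inv_one_add_abs_cube_le x, mul_le_mul_of_nonneg_right (abs_log_le x) h2]

lemma inv_one_add_abs_sub_cube_le (x z : ℝ) :
    ((1 + |x - z|) ^ 3)⁻¹ ≤ (1 + |x|) ^ 3 * ((1 + |z|) ^ 3)⁻¹ := by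
  rw [← div_eq_mul_inv, le_div_iff₀ (by positivity), inv_mul_le_iff₀ (by positivity), ← mul_pow]
  gcongr
  have : |z| ≤ |x - z| + |x| := by linarith [abs_sub_abs_le_abs_sub z x, abs_sub_comm x z]
  nlinarith [abs_nonneg x, abs_nonneg (x - z)]

lemma abs_log_mul_comp_sub_le (f : SchwartzMap ℝ ℝ) (x z : ℝ) :
    ‖Real.log z * f (x - z)‖ ≤
      decayNorm f * (1 + |x|) ^ 3 * (|Real.log z| * ((1 + |z|) ^ 3)⁻¹) := by
  rw [norm_mul, Real.norm_eq_abs, Real.norm_eq_abs]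
  calc |Real.log z| * |f (x - z)|
      ≤ |Real.log z| * (decayNorm f * ((1 + |x|) ^ 3 * ((1 + |z|) ^ 3)⁻¹)) := by
        gcongr
        exact (abs_le_decayNorm_mul f _).trans
          (mul_le_mul_of_nonneg_left (inv_one_add_abs_sub_cube_le x z) (decayNorm_nonneg f))
    _ = _ := by ring

lemma aestronglyMeasurable_log_mul_comp_sub (f : SchwartzMap ℝ ℝ) (x : ℝ) :
    AEStronglyMeasurable (fun z => Real.log z * f (x - z)) := by
  have := f.continuous
  exact (Real.measurable_log.mul (by fun_prop)).aestronglyMeasurable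

lemma integrable_log_mul_comp_sub (f : SchwartzMap ℝ ℝ) (x : ℝ) :
    Integrable (fun z => Real.log z * f (x - z)) :=
  (integrable_log_mul_inv_one_add_abs_cube.const_mul _).mono'
    (aestronglyMeasurable_log_mul_comp_sub f x) (.of_forall (abs_log_mul_comp_sub_le f x))

lemma integrable_log_sub_mul (f : SchwartzMap ℝ ℝ) (x : ℝ) :
    Integrable (fun y => Real.log (x - y) * f y) := by
  simpa using (integrable_log_mul_comp_sub f x).comp_sub_left x

lemma logConv_eq (f : ℝ → ℝ) (x : ℝ) : logConv f x = ∫ y, Real.log (x - y) * f y := by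
  rw [logConv, ← integral_sub_left_eq_self _ _ x]
  simp

lemma hasDerivAt_logConv (f : SchwartzMap ℝ ℝ) (x : ℝ) :
    HasDerivAt (logConv f) (logConv (schwartzDeriv f) x) x := by
  refine (hasDerivAt_integral_of_dominated_loc_of_deriv_le (Metric.ball_mem_nhds x one_pos)
    (.of_forall fun y => aestronglyMeasurable_log_mul_comp_sub f y)
    (integrable_log_mul_comp_sub f x)
    (F' := fun y z => Real.log z * schwartzDeriv f (y - z))
    (aestronglyMeasurable_log_mul_comp_sub _ x)
    (bound := fun z => decayNorm (schwartzDeriv f) * (1 + (|x| + 1)) ^ 3 *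
      (|Real.log z| * ((1 + |z|) ^ 3)⁻¹))
    (.of_forall fun z y hy => ?_) (integrable_log_mul_inv_one_add_abs_cube.const_mul _)
    (.of_forall fun z y _ => ?_)).2
  · refine (abs_log_mul_comp_sub_le (schwartzDeriv f) y z).trans ?_
    have := decayNorm_nonneg (schwartzDeriv f)
    have hy' : |y| ≤ |x| + 1 := by
      rw [Metric.mem_ball, Real.dist_eq] at hy
      linarith [abs_sub_abs_le_abs_sub y x]
    gcongr
  · exact ((hasDerivAt_schwartz f (y - z)).comp_sub_const y z).const_mul _

lemma integral_schwartzDeriv (f : SchwartzMap ℝ ℝ) : ∫ x, schwartzDeriv f x = 0 :=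
  integral_eq_zero_of_hasDerivAt_of_integrable (hasDerivAt_schwartz f)
    (schwartzDeriv f).integrable f.integrable

lemma integrable_posLog_inv_mul (f : SchwartzMap ℝ ℝ) (x : ℝ) :
    Integrable (fun z => Real.posLog z⁻¹ * f (x - z)) := by
  have := f.continuous
  exact integrable_posLog_inv.mul_bdd (by fun_prop) (.of_forall fun z => abs_le_decayNorm f _)

lemma abs_posLog_sub_mul_le (f : SchwartzMap ℝ ℝ) (x y : ℝ) :
    ‖(Real.posLog (x - y) - Real.posLog x) * f y‖ ≤ decayNorm f * ((1 + |y|) ^ 2)⁻¹ := by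
  rw [norm_mul, Real.norm_eq_abs, Real.norm_eq_abs]
  have h1 : |Real.posLog (x - y) - Real.posLog x| ≤ |y| := by
    simpa using abs_posLog_sub_posLog_le (x - y) x
  calc _ ≤ |y| * (decayNorm f * ((1 + |y|) ^ 3)⁻¹) := by
        gcongr
        exact abs_le_decayNorm_mul f y
    _ = decayNorm f * (|y| * ((1 + |y|) ^ 3)⁻¹) := by ring
    _ ≤ _ := mul_le_mul_of_nonneg_left (abs_mul_inv_one_add_abs_cube_le y) (decayNorm_nonneg f)

lemma aestronglyMeasurable_posLog_sub_mul (f : SchwartzMap ℝ ℝ) (x : ℝ) :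
    AEStronglyMeasurable (fun y => (Real.posLog (x - y) - Real.posLog x) * f y) := by
  have := f.continuous
  have := Real.continuous_posLog
  exact Continuous.aestronglyMeasurable (by fun_prop)

lemma logConv_schwartzDeriv_eq (g : SchwartzMap ℝ ℝ) (x : ℝ) :
    logConv (schwartzDeriv g) x =
      (∫ y, (Real.posLog (x - y) - Real.posLog x) * schwartzDeriv g y) -
        ∫ z, Real.posLog z⁻¹ * schwartzDeriv g (x - z) := by
  set h := schwartzDeriv g with hh
  have h1 := integrable_posLog_inv_mul h x
  have h2 : Integrable (fun z => Real.posLog z * h (x - z)) := by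
    refine ((integrable_log_mul_comp_sub h x).add h1).congr (.of_forall fun z => ?_)
    simp only [Pi.add_apply, ← Real.posLog_sub_posLog_inv (x := z)]
    ring
  have h3 : ∫ z, Real.posLog z * h (x - z) = ∫ y, Real.posLog (x - y) * h y := by
    rw [← integral_sub_left_eq_self _ _ x]
    simp
  have h4 : Integrable (fun y => Real.posLog (x - y) * h y) := by
    simpa using h2.comp_sub_left x
  have h5 : ∫ y, (Real.posLog (x - y) - Real.posLog x) * h y =
      ∫ y, Real.posLog (x - y) * h y := by
    simp_rw [sub_mul]
    rw [integral_sub h4 (h.integrable.const_mul _), integral_const_mul, hh,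
      integral_schwartzDeriv g, mul_zero, sub_zero]
  rw [h5, ← h3, ← integral_sub h2 h1, logConv]
  congr with z
  rw [← Real.posLog_sub_posLog_inv]
  ring

lemma exists_abs_logConv_schwartzDeriv_le : ∃ K : ℝ, 0 ≤ K ∧
    ∀ (g : SchwartzMap ℝ ℝ) (x : ℝ),
      |logConv (schwartzDeriv g) x| ≤ K * decayNorm (schwartzDeriv g) := by
  refine ⟨(∫ y : ℝ, ((1 + |y|) ^ 2)⁻¹) + ∫ z : ℝ, Real.posLog z⁻¹,
    add_nonneg (integral_nonneg fun _ => by positivity)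
      (integral_nonneg fun _ => Real.posLog_nonneg), fun g x => ?_⟩
  rw [logConv_schwartzDeriv_eq, add_mul]
  refine (abs_sub _ _).trans (add_le_add ?_ ?_)
  · rw [mul_comm, ← integral_const_mul]
    exact norm_integral_le_of_norm_le (integrable_inv_one_add_abs_sq.const_mul _)
      (.of_forall fun y => abs_posLog_sub_mul_le _ x y)
  · rw [← integral_mul_const, ← Real.norm_eq_abs]
    refine norm_integral_le_of_norm_le (integrable_posLog_inv.mul_const _)
      (.of_forall fun z => ?_)
    rw [norm_mul, Real.norm_of_nonneg Real.posLog_nonneg]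
    exact mul_le_mul_of_nonneg_left (abs_le_decayNorm _ _) Real.posLog_nonneg

lemma tendsto_posLog_sub_posLog (y : ℝ) :
    Tendsto (fun x => Real.posLog (x - y) - Real.posLog x) (cocompact ℝ) (nhds 0) := by
  have hinv : Tendsto (fun x : ℝ => x⁻¹) (cocompact ℝ) (nhds 0) := by
    rw [← Metric.cobounded_eq_cocompact]
    exact tendsto_inv₀_cobounded
  have h1 : Tendsto (fun x : ℝ => Real.log (1 - y * x⁻¹)) (cocompact ℝ) (nhds 0) := by
    have h2 : Tendsto (fun x : ℝ => 1 - y * x⁻¹) (cocompact ℝ) (nhds 1) := by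
      simpa using (hinv.const_mul y).const_sub 1
    simpa using h2.log one_ne_zero
  refine h1.congr' ?_
  have hlarge : ∀ᶠ x : ℝ in cocompact ℝ, 1 + |y| ≤ |x| :=
    tendsto_norm_cocompact_atTop.eventually_ge_atTop (1 + |y|)
  filter_upwards [hlarge] with x hx
  have hx1 : 1 ≤ |x| := by linarith [abs_nonneg y]
  have hx2 : 1 ≤ |x - y| := by linarith [abs_sub_abs_le_abs_sub x y]
  have hx0 : x ≠ 0 := abs_pos.1 (by linarith)
  have hxy0 : x - y ≠ 0 := abs_pos.1 (by linarith)
  rw [Real.posLog_eq_log hx1, Real.posLog_eq_log hx2, ← Real.log_div hxy0 hx0]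
  congr 1
  field_simp

lemma tendsto_logConv_schwartzDeriv (g : SchwartzMap ℝ ℝ) :
    Tendsto (logConv (schwartzDeriv g)) (cocompact ℝ) (nhds 0) := by
  have hcg : (cocompact ℝ).IsCountablyGenerated := by
    rw [cocompact_eq_atBot_atTop]
    infer_instance
  have h1 : Tendsto (fun x => ∫ y, (Real.posLog (x - y) - Real.posLog x) * schwartzDeriv g y)
      (cocompact ℝ) (nhds (∫ _ : ℝ, (0 : ℝ))) := by
    refine tendsto_integral_filter_of_dominated_convergence _
      (.of_forall fun x => aestronglyMeasurable_posLog_sub_mul _ x)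
      (.of_forall fun x => .of_forall fun y => abs_posLog_sub_mul_le _ x y)
      (integrable_inv_one_add_abs_sq.const_mul _) (.of_forall fun y => ?_)
    simpa using (tendsto_posLog_sub_posLog y).mul_const (schwartzDeriv g y)
  have h2 : Tendsto (fun x => ∫ z, Real.posLog z⁻¹ * schwartzDeriv g (x - z))
      (cocompact ℝ) (nhds (∫ _ : ℝ, (0 : ℝ))) := by
    refine tendsto_integral_filter_of_dominated_convergence
      (fun z => Real.posLog z⁻¹ * decayNorm (schwartzDeriv g))
      (.of_forall fun x => (integrable_posLog_inv_mul _ x).aestronglyMeasurable)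
      (.of_forall fun x => .of_forall fun z => ?_)
      (integrable_posLog_inv.mul_const _) (.of_forall fun z => ?_)
    · rw [norm_mul, Real.norm_of_nonneg Real.posLog_nonneg]
      exact mul_le_mul_of_nonneg_left (abs_le_decayNorm _ _) Real.posLog_nonneg
    · have h3 : Tendsto (fun x : ℝ => x - z) (cocompact ℝ) (cocompact ℝ) :=
        (Homeomorph.subRight z).isClosedEmbedding.tendsto_cocompact
      simpa using ((zero_at_infty (schwartzDeriv g)).comp h3).const_mul (Real.posLog z⁻¹)
  simpa only [← logConv_schwartzDeriv_eq, integral_zero, sub_zero] using h1.sub h2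

lemma integrable_mul_log_sub_mul_prod (f g : SchwartzMap ℝ ℝ) :
    Integrable (fun p : ℝ × ℝ => f p.1 * (Real.log (p.1 - p.2) * g p.2))
      (volume.prod volume) := by
  have hf := f.continuous
  have hg := g.continuous
  have h1 : Integrable (fun p : ℝ × ℝ => g p.2 * Real.posLog (p.1 - p.2)⁻¹)
      (volume.prod volume) := by
    simpa using g.integrable.convolution_integrand (ContinuousLinearMap.mul ℝ ℝ)
      integrable_posLog_inv
  have hmom (φ : SchwartzMap ℝ ℝ) : Integrable (fun x => |x| * |φ x|) := by
    have hφ := φ.continuous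
    refine (integrable_inv_one_add_abs_sq.const_mul (decayNorm φ)).mono' (by fun_prop)
      (.of_forall fun x => ?_)
    rw [Real.norm_of_nonneg (by positivity)]
    have h2 := mul_le_mul_of_nonneg_left (abs_le_decayNorm_mul φ x) (abs_nonneg x)
    have h3 := mul_le_mul_of_nonneg_left (abs_mul_inv_one_add_abs_cube_le x) (decayNorm_nonneg φ)
    linarith
  have h2 := (hmom f).mul_prod (g.integrable (μ := volume)).norm
  have h3 := (f.integrable (μ := volume)).norm.mul_prod (hmom g)
  refine ((h1.norm.const_mul (decayNorm f)).add (h2.add h3)).mono' ?_ (.of_forall fun p => ?_)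
  · have : Measurable fun p : ℝ × ℝ => Real.log (p.1 - p.2) :=
      Real.measurable_log.comp (by fun_prop)
    exact Measurable.aestronglyMeasurable (by fun_prop)
  · have hp : 0 ≤ Real.posLog (p.1 - p.2)⁻¹ := Real.posLog_nonneg
    simp only [Pi.add_apply, norm_mul, Real.norm_eq_abs, abs_of_nonneg hp]
    have hlog : |Real.log (p.1 - p.2)| ≤ Real.posLog (p.1 - p.2)⁻¹ + (|p.1| + |p.2|) :=
      (abs_log_le _).trans (by gcongr; exact abs_sub _ _)
    calc |f p.1| * (|Real.log (p.1 - p.2)| * |g p.2|)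
        ≤ |f p.1| * ((Real.posLog (p.1 - p.2)⁻¹ + (|p.1| + |p.2|)) * |g p.2|) := by gcongr
      _ = |f p.1| * (|g p.2| * Real.posLog (p.1 - p.2)⁻¹) + (|p.1| * |f p.1| * |g p.2| +
          |f p.1| * (|p.2| * |g p.2|)) := by ring
      _ ≤ _ := by
        gcongr
        exact abs_le_decayNorm f _

lemma integral_mul_logConv_comm (f g : SchwartzMap ℝ ℝ) :
    ∫ x, f x * logConv g x = ∫ x, g x * logConv f x := by
  simp_rw [logConv_eq, ← integral_const_mul]
  rw [integral_integral_swap (integrable_mul_log_sub_mul_prod f g)]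
  congr with x
  congr with y
  rw [← Real.log_neg_eq_log, neg_sub]
  ring

lemma continuous_logConv (f : SchwartzMap ℝ ℝ) : Continuous (logConv f) :=
  continuous_iff_continuousAt.2 fun x => (hasDerivAt_logConv f x).continuousAt

lemma integrable_mul_logConv_schwartzDeriv (f g : SchwartzMap ℝ ℝ) :
    Integrable (fun x => f x * logConv (schwartzDeriv g) x) := by
  obtain ⟨K, -, hK⟩ := exists_abs_logConv_schwartzDeriv_le
  exact f.integrable.mul_bdd (continuous_logConv _).aestronglyMeasurable
    (.of_forall fun x => hK g x)

/-- The bilinear form `∫ f · H(g_x)` is symmetric. -/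
lemma integral_mul_logConv_schwartzDeriv_schwartzDeriv_comm (f g : SchwartzMap ℝ ℝ) :
    ∫ x, f x * logConv (schwartzDeriv (schwartzDeriv g)) x =
      ∫ x, g x * logConv (schwartzDeriv (schwartzDeriv f)) x := by
  have key (f g : SchwartzMap ℝ ℝ) :
      ∫ x, f x * logConv (schwartzDeriv (schwartzDeriv g)) x =
        -∫ x, schwartzDeriv f x * logConv (schwartzDeriv g) x :=
    integral_mul_deriv_eq_deriv_mul_of_integrable (fun x _ => hasDerivAt_schwartz f x)
      (fun x _ => hasDerivAt_logConv (schwartzDeriv g) x)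
      (integrable_mul_logConv_schwartzDeriv _ _) (integrable_mul_logConv_schwartzDeriv _ _)
      (integrable_mul_logConv_schwartzDeriv _ _)
  rw [key, key, integral_mul_logConv_comm]

lemma setOf_lt_abs_sub_eq (ε x : ℝ) :
    {y : ℝ | ε < |x - y|} = Set.Iio (x - ε) ∪ Set.Ioi (x + ε) := by
  ext y
  simp only [Set.mem_ofPred_eq, lt_abs, Set.mem_union, Set.mem_Iio, Set.mem_Ioi]
  constructor <;> rintro (h | h)
  · exact .inl (by linarith)
  · exact .inr (by linarith)
  · exact .inl (by linarith)
  · exact .inr (by linarith)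

lemma measurableSet_lt_abs_sub (ε x : ℝ) : MeasurableSet {y : ℝ | ε < |x - y|} :=
  measurableSet_lt measurable_const (by fun_prop)

lemma integrableOn_div_sub (f : SchwartzMap ℝ ℝ) {ε : ℝ} (hε : 0 < ε) (x : ℝ) :
    IntegrableOn (fun y => f y / (x - y)) {y : ℝ | ε < |x - y|} := by
  have hf := f.continuous
  refine (f.integrable.norm.const_mul ε⁻¹).integrableOn.mono'
    (Measurable.aestronglyMeasurable (by fun_prop)) ?_
  filter_upwards [ae_restrict_mem (measurableSet_lt_abs_sub ε x)] with y hy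
  have hy' : ε < |x - y| := hy
  rw [norm_div, div_eq_inv_mul, Real.norm_eq_abs (x - y)]
  gcongr

lemma setIntegral_div_sub_eq (f : SchwartzMap ℝ ℝ) {ε : ℝ} (hε : 0 < ε) (x : ℝ) :
    ∫ y in {y : ℝ | ε < |x - y|}, f y / (x - y) =
      (∫ y in {y : ℝ | ε < |x - y|}, Real.log (x - y) * schwartzDeriv f y) +
        (f (x + ε) - f (x - ε)) * Real.log ε := by
  have hd : ∀ y, y ≠ x → HasDerivAt (fun y => Real.log (x - y) * f y)
      (Real.log (x - y) * schwartzDeriv f y - f y / (x - y)) y := by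
    intro y hy
    have h1 : HasDerivAt (fun y => Real.log (x - y)) (-1 / (x - y)) y :=
      ((hasDerivAt_id y).const_sub x).log (sub_ne_zero.2 hy.symm)
    exact (h1.mul (hasDerivAt_schwartz f y)).congr_deriv (by ring)
  have hint := integrable_log_sub_mul f x
  have hint' := integrable_log_sub_mul (schwartzDeriv f) x
  have hdiv := integrableOn_div_sub f hε x
  have hall : IntegrableOn (fun y => Real.log (x - y) * schwartzDeriv f y - f y / (x - y))
      {y : ℝ | ε < |x - y|} := hint'.integrableOn.sub hdiv
  have hsub : ∫ y in {y : ℝ | ε < |x - y|},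
      (Real.log (x - y) * schwartzDeriv f y - f y / (x - y)) =
        (∫ y in {y : ℝ | ε < |x - y|}, Real.log (x - y) * schwartzDeriv f y) -
          ∫ y in {y : ℝ | ε < |x - y|}, f y / (x - y) :=
    integral_sub hint'.integrableOn hdiv
  have hr : IntegrableOn (fun y => Real.log (x - y) * schwartzDeriv f y - f y / (x - y))
      (Set.Ioi (x + ε)) :=
    hall.mono_set (by rw [setOf_lt_abs_sub_eq]; exact Set.subset_union_right)
  have hl : IntegrableOn (fun y => Real.log (x - y) * schwartzDeriv f y - f y / (x - y))
      (Set.Iio (x - ε)) :=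
    hall.mono_set (by rw [setOf_lt_abs_sub_eq]; exact Set.subset_union_left)
  have hl' : IntegrableOn (fun y => Real.log (x - y) * schwartzDeriv f y - f y / (x - y))
      (Set.Iic (x - ε)) := (integrableOn_Iic_iff_integrableOn_Iio).2 hl
  have hdr : ∀ y ∈ Set.Ici (x + ε), HasDerivAt (fun y => Real.log (x - y) * f y)
      (Real.log (x - y) * schwartzDeriv f y - f y / (x - y)) y := fun y hy =>
    hd y (by have := Set.mem_Ici.1 hy; exact (by linarith : x < y).ne')
  have hdl : ∀ y ∈ Set.Iic (x - ε), HasDerivAt (fun y => Real.log (x - y) * f y)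
      (Real.log (x - y) * schwartzDeriv f y - f y / (x - y)) y := fun y hy =>
    hd y (by have := Set.mem_Iic.1 hy; exact (by linarith : y < x).ne)
  have hR := integral_Ioi_of_hasDerivAt_of_tendsto' hdr hr
    (tendsto_zero_of_hasDerivAt_of_integrableOn_Ioi
      (fun y hy => hdr y (Set.Ioi_subset_Ici_self hy)) hr hint.integrableOn)
  have hL := integral_Iic_of_hasDerivAt_of_tendsto' hdl hl'
    (tendsto_zero_of_hasDerivAt_of_integrableOn_Iic hdl hl' hint.integrableOn)
  rw [integral_Iic_eq_integral_Iio] at hL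
  have hdisj : Disjoint (Set.Iio (x - ε)) (Set.Ioi (x + ε)) := by
    rw [Set.disjoint_left]
    intro y hy hy'
    rw [Set.mem_Iio] at hy
    rw [Set.mem_Ioi] at hy'
    linarith
  have hunion : ∫ y in {y : ℝ | ε < |x - y|},
      (Real.log (x - y) * schwartzDeriv f y - f y / (x - y)) =
        (f (x - ε) - f (x + ε)) * Real.log ε := by
    rw [setOf_lt_abs_sub_eq, setIntegral_union hdisj measurableSet_Ioi hl hr, hL, hR,
      sub_sub_cancel, sub_add_cancel_left, Real.log_neg_eq_log]
    ring
  linarith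

lemma hilbertPVR_schwartz (f : SchwartzMap ℝ ℝ) (x : ℝ) :
    HilbertPVR f x (1 / Real.pi * logConv (schwartzDeriv f) x) := by
  refine Tendsto.const_mul _ ?_
  have hboundary : Tendsto (fun ε => (f (x + ε) - f (x - ε)) * Real.log ε)
      (nhdsWithin 0 (Set.Ioi 0)) (nhds 0) := by
    have hd : HasDerivAt (fun ε => f (x + ε) - f (x - ε))
        (schwartzDeriv f (x + 0) - -schwartzDeriv f (x - 0)) 0 :=
      ((hasDerivAt_schwartz f (x + 0)).comp_const_add x 0).sub
        ((hasDerivAt_schwartz f (x - 0)).comp_const_sub x 0)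
    have hO : (fun ε => f (x + ε) - f (x - ε)) =O[nhdsWithin 0 (Set.Ioi 0)] fun ε => ε := by
      simpa using hd.isBigO_sub.mono nhdsWithin_le_nhds
    have hlog : Tendsto (fun ε : ℝ => ε * Real.log ε) (nhdsWithin 0 (Set.Ioi 0)) (nhds 0) := by
      simpa [mul_comm] using tendsto_log_mul_rpow_nhdsGT_zero one_pos
    exact (hO.mul (Asymptotics.isBigO_refl Real.log _)).trans_tendsto hlog
  have hmain : Tendsto (fun ε => ∫ y in {y : ℝ | ε < |x - y|},
      Real.log (x - y) * schwartzDeriv f y)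
      (nhdsWithin 0 (Set.Ioi 0)) (nhds (logConv (schwartzDeriv f) x)) := by
    rw [logConv_eq]
    have hint := integrable_log_sub_mul (schwartzDeriv f) x
    simp_rw [← fun ε => integral_indicator (μ := volume)
      (f := fun y => Real.log (x - y) * schwartzDeriv f y) (measurableSet_lt_abs_sub ε x)]
    refine tendsto_integral_filter_of_dominated_convergence _
      (.of_forall fun ε => hint.aestronglyMeasurable.indicator (measurableSet_lt_abs_sub ε x))
      (.of_forall fun ε => .of_forall fun y => norm_indicator_le_norm_self _ _) hint.norm ?_
    have hne : ∀ᵐ y : ℝ, y ≠ x := by simp [ae_iff]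
    filter_upwards [hne] with y hy
    refine tendsto_nhds_of_eventually_eq ?_
    have hpos : 0 < |x - y| := abs_pos.2 (sub_ne_zero.2 hy.symm)
    filter_upwards [nhdsWithin_le_nhds (Iio_mem_nhds hpos)] with ε hε
    exact Set.indicator_of_mem (s := {y : ℝ | ε < |x - y|}) hε _
  have hsum := hmain.add hboundary
  rw [add_zero] at hsum
  refine hsum.congr' ?_
  filter_upwards [self_mem_nhdsWithin] with ε hε
  exact (setIntegral_div_sub_eq f hε x).symm

lemma HilbertPVR.unique {f : ℝ → ℝ} {x A B : ℝ} (hA : HilbertPVR f x A)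
    (hB : HilbertPVR f x B) : A = B :=
  tendsto_nhds_unique hA hB

lemma logConv_sub (f g : SchwartzMap ℝ ℝ) (x : ℝ) :
    logConv (f - g : SchwartzMap ℝ ℝ) x = logConv f x - logConv g x := by
  rw [logConv, logConv, logConv, ← integral_sub (integrable_log_mul_comp_sub f x)
    (integrable_log_mul_comp_sub g x)]
  simp [mul_sub]

lemma tendsto_decayNorm_sub {v : ℝ → SchwartzMap ℝ ℝ} (hv : Continuous v) (s : ℝ) :
    Tendsto (fun t => decayNorm (v t - v s)) (nhds s) (nhds 0) := by
  have h : Continuous fun t => decayNorm (v t - v s) :=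
    continuous_decayNorm.comp (hv.sub continuous_const)
  simpa [decayNorm] using h.tendsto s

lemma exists_ball_decayNorm_le {v : ℝ → SchwartzMap ℝ ℝ} (hv : Continuous v) (s : ℝ) :
    ∃ δ > 0, ∃ C, ∀ t ∈ Metric.ball s δ, decayNorm (v t) ≤ C := by
  have h := (continuous_decayNorm.comp hv).tendsto s
  obtain ⟨δ, hδ, hball⟩ := Metric.eventually_nhds_iff_ball.1
    (h.eventually (gt_mem_nhds (lt_add_one (decayNorm (v s)))))
  exact ⟨δ, hδ, _, fun t ht => (hball t ht).le⟩

lemma schwartzDeriv_sub (f g : SchwartzMap ℝ ℝ) :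
    schwartzDeriv (f - g) = schwartzDeriv f - schwartzDeriv g := map_sub _ f g

lemma integrable_pow_mul (f g : SchwartzMap ℝ ℝ) (m : ℕ) :
    Integrable (fun x => f x ^ m * g x) := by
  refine g.integrable.bdd_mul (c := decayNorm f ^ m)
    (f.continuous.pow _).aestronglyMeasurable (.of_forall fun x => ?_)
  rw [norm_pow, Real.norm_eq_abs]
  exact pow_le_pow_left₀ (abs_nonneg _) (abs_le_decayNorm _ _) _

section EnergyDerivative

variable {u u' : ℝ → SchwartzMap ℝ ℝ}

lemma hasDerivAt_integral_pow (hu_cont : Continuous u) (hu'_cont : Continuous u')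
    (hderiv : ∀ t x : ℝ, HasDerivAt (fun s : ℝ => u s x) (u' t x) t) (m : ℕ) (s : ℝ) :
    HasDerivAt (fun t => ∫ x, u t x ^ (m + 1))
      (∫ x, ((m : ℝ) + 1) * u s x ^ m * u' s x) s := by
  obtain ⟨δ₁, hδ₁, C₁, hC₁⟩ := exists_ball_decayNorm_le hu_cont s
  obtain ⟨δ₂, hδ₂, C₂, hC₂⟩ := exists_ball_decayNorm_le hu'_cont s
  have hC₁_nonneg : 0 ≤ C₁ := (decayNorm_nonneg _).trans (hC₁ s (Metric.mem_ball_self hδ₁))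
  have hmeas (t : ℝ) : AEStronglyMeasurable (fun x => u t x ^ (m + 1)) :=
    ((u t).continuous.pow _).aestronglyMeasurable
  have hmeas' : AEStronglyMeasurable (fun x => ((m : ℝ) + 1) * u s x ^ m * u' s x) :=
    ((continuous_const.mul ((u s).continuous.pow _)).mul (u' s).continuous).aestronglyMeasurable
  refine (hasDerivAt_integral_of_dominated_loc_of_deriv_le
    (inter_mem (Metric.ball_mem_nhds s hδ₁) (Metric.ball_mem_nhds s hδ₂))
    (.of_forall hmeas) ?_ (F' := fun t x => ((m : ℝ) + 1) * u t x ^ m * u' t x) hmeas'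
    (bound := fun x => ((m : ℝ) + 1) * C₁ ^ m * (C₂ * ((1 + |x|) ^ 3)⁻¹))
    (.of_forall fun x t ht => ?_) ((integrable_inv_one_add_abs_cube.const_mul _).const_mul _)
    (.of_forall fun x t _ => ?_)).2
  · simp_rw [pow_succ]
    exact integrable_pow_mul (u s) (u s) m
  · rw [norm_mul, norm_mul, norm_pow, Real.norm_of_nonneg (by positivity), Real.norm_eq_abs,
      Real.norm_eq_abs]
    gcongr
    · exact (abs_le_decayNorm _ _).trans (hC₁ t ht.1)
    · exact (abs_le_decayNorm_mul _ _).trans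
        (mul_le_mul_of_nonneg_right (hC₂ t ht.2) (by positivity))
  · simpa using (hderiv t x).fun_pow (m + 1)

lemma integral_mul_logConv_sub (f g : SchwartzMap ℝ ℝ) :
    (∫ x, f x * logConv (schwartzDeriv (schwartzDeriv f)) x) -
        ∫ x, g x * logConv (schwartzDeriv (schwartzDeriv g)) x =
      ∫ x, (f x - g x) * (logConv (schwartzDeriv (schwartzDeriv f)) x +
        logConv (schwartzDeriv (schwartzDeriv g)) x) := by
  have hint (φ ψ : SchwartzMap ℝ ℝ) :
      Integrable (fun x => φ x * logConv (schwartzDeriv (schwartzDeriv ψ)) x) :=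
    integrable_mul_logConv_schwartzDeriv _ _
  have hsum : ∫ x, (f x - g x) * (logConv (schwartzDeriv (schwartzDeriv f)) x +
        logConv (schwartzDeriv (schwartzDeriv g)) x) =
      ∫ x, ((f x * logConv (schwartzDeriv (schwartzDeriv f)) x -
          g x * logConv (schwartzDeriv (schwartzDeriv g)) x) +
        (f x * logConv (schwartzDeriv (schwartzDeriv g)) x -
          g x * logConv (schwartzDeriv (schwartzDeriv f)) x)) := by
    congr with x
    ring
  have hfg : Integrable (fun x => f x * logConv (schwartzDeriv (schwartzDeriv g)) x -
      g x * logConv (schwartzDeriv (schwartzDeriv f)) x) := (hint f g).sub (hint g f)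
  have hff : Integrable (fun x => f x * logConv (schwartzDeriv (schwartzDeriv f)) x -
      g x * logConv (schwartzDeriv (schwartzDeriv g)) x) := (hint f f).sub (hint g g)
  rw [hsum, integral_add hff hfg,
    integral_sub (hint f f) (hint g g), integral_sub (hint f g) (hint g f),
    integral_mul_logConv_schwartzDeriv_schwartzDeriv_comm f g, sub_self, add_zero]

lemma hasDerivAt_integral_mul_logConv (hu_cont : Continuous u) (hu'_cont : Continuous u')
    (hderiv : ∀ t x : ℝ, HasDerivAt (fun s : ℝ => u s x) (u' t x) t) (s : ℝ) :
    HasDerivAt (fun t => ∫ x, u t x * logConv (schwartzDeriv (schwartzDeriv (u t))) x)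
      (∫ x, u' s x * (2 * logConv (schwartzDeriv (schwartzDeriv (u s))) x)) s := by
  obtain ⟨K, hK_nonneg, hK⟩ := exists_abs_logConv_schwartzDeriv_le
  have hv : Continuous fun t => schwartzDeriv (schwartzDeriv (u t)) :=
    (SchwartzMap.derivCLM ℝ ℝ).continuous.comp ((SchwartzMap.derivCLM ℝ ℝ).continuous.comp hu_cont)
  obtain ⟨δ₂, hδ₂, C₂, hC₂⟩ := exists_ball_decayNorm_le hu'_cont s
  have hlim (x : ℝ) : Tendsto (fun t => logConv (schwartzDeriv (schwartzDeriv (u t))) x)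
      (nhds s) (nhds (logConv (schwartzDeriv (schwartzDeriv (u s))) x)) := by
    rw [tendsto_iff_norm_sub_tendsto_zero]
    refine squeeze_zero (fun t => norm_nonneg _) (fun t => ?_)
      (by simpa using (tendsto_decayNorm_sub hv s).const_mul K)
    rw [← logConv_sub, ← schwartzDeriv_sub, ← schwartzDeriv_sub]
    exact hK _ x
  obtain ⟨δ₁, hδ₁, C₁, hC₁⟩ := exists_ball_decayNorm_le hv s
  have hbound : ∀ t ∈ Metric.ball s δ₁, ∀ x,
      |logConv (schwartzDeriv (schwartzDeriv (u t))) x| ≤ K * C₁ := fun t ht x =>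
    (hK _ x).trans (mul_le_mul_of_nonneg_left (hC₁ t ht) hK_nonneg)
  rw [hasDerivAt_iff_tendsto_slope]
  have hslope (t : ℝ) : slope (fun t => ∫ x, u t x *
      logConv (schwartzDeriv (schwartzDeriv (u t))) x) s t =
        ∫ x, slope (fun t => u t x) s t *
          (logConv (schwartzDeriv (schwartzDeriv (u t))) x +
            logConv (schwartzDeriv (schwartzDeriv (u s))) x) := by
    simp_rw [slope_def_module, integral_mul_logConv_sub, smul_eq_mul, mul_assoc,
      integral_const_mul]
  have hslope_le (x t : ℝ) (ht : t ∈ Metric.ball s δ₂) (hts : t ≠ s) :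
      |slope (fun t => u t x) s t| ≤ C₂ * ((1 + |x|) ^ 3)⁻¹ := by
    have h := (convex_ball s δ₂).norm_image_sub_le_of_norm_hasDerivWithin_le
      (fun r _ => (hderiv r x).hasDerivWithinAt)
      (fun r hr => (abs_le_decayNorm_mul (u' r) x).trans
        (mul_le_mul_of_nonneg_right (hC₂ r hr) (by positivity)))
      (Metric.mem_ball_self hδ₂) ht
    rw [slope_def_field, abs_div, div_le_iff₀ (abs_pos.2 (sub_ne_zero.2 hts))]
    exact h
  simp_rw [funext hslope]
  have hball : ∀ᶠ t in nhdsWithin s {s}ᶜ,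
      t ∈ Metric.ball s δ₁ ∧ t ∈ Metric.ball s δ₂ ∧ t ≠ s := by
    filter_upwards [nhdsWithin_le_nhds (Metric.ball_mem_nhds s hδ₁),
      nhdsWithin_le_nhds (Metric.ball_mem_nhds s hδ₂), self_mem_nhdsWithin] with t h1 h2 h3
    exact ⟨h1, h2, h3⟩
  refine tendsto_integral_filter_of_dominated_convergence
    (fun x => C₂ * ((1 + |x|) ^ 3)⁻¹ * (K * C₁ + K * C₁)) (.of_forall fun t => ?_) ?_
    ((integrable_inv_one_add_abs_cube.const_mul _).mul_const _) (.of_forall fun x => ?_)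
  · simp_rw [slope_def_field]
    have h1 := (u t).continuous
    have h2 := (u s).continuous
    have h3 := continuous_logConv (schwartzDeriv (schwartzDeriv (u t)))
    have h4 := continuous_logConv (schwartzDeriv (schwartzDeriv (u s)))
    exact Continuous.aestronglyMeasurable (by fun_prop)
  · filter_upwards [hball] with t ht
    refine .of_forall fun x => ?_
    rw [norm_mul]
    have h1 := hslope_le x t ht.2.1 ht.2.2
    exact mul_le_mul h1
      ((abs_add_le _ _).trans (add_le_add (hbound t ht.1 x)
        (hbound s (Metric.mem_ball_self hδ₁) x)))
      (norm_nonneg _) ((abs_nonneg _).trans h1)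
  · rw [two_mul]
    exact (hasDerivAt_iff_tendsto_slope.1 (hderiv s x)).mul
      (((hlim x).mono_left nhdsWithin_le_nhds).add_const _)

end EnergyDerivative

/-- Pairing `v_x` with `v` itself integrates to zero when `v` vanishes at infinity. -/
lemma integral_deriv_mul_self_eq_zero {F F' : ℝ → ℝ} (hF : ∀ x, HasDerivAt F (F' x) x)
    (hint : Integrable fun x => F' x * F x) (hlim : Tendsto F (cocompact ℝ) (nhds 0)) :
    ∫ x, F' x * F x = 0 := by
  have hd (x : ℝ) : HasDerivAt (fun x => F x ^ 2 / 2) (F' x * F x) x :=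
    (((hF x).fun_pow 2).div_const 2).congr_deriv (by ring)
  have hlim' : Tendsto (fun x => F x ^ 2 / 2) (cocompact ℝ) (nhds 0) := by
    simpa using (hlim.pow 2).div_const 2
  have h := integral_of_hasDerivAt_of_tendsto hd hint (hlim'.mono_left atBot_le_cocompact)
    (hlim'.mono_left atTop_le_cocompact)
  rwa [sub_zero] at h

/-- Conservation of energy for the gBO equation: if `t ↦ u(·,t)` is a C¹ curve of
Schwartz functions solving `u_t = H u_xx - u^{m-1} u_x`, then
`E[u(t)] = (1/2) ∫ u · H(u_x) dx - (1/(m(m+1))) ∫ u^{m+1} dx` is independent of `t`. -/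
theorem gBO_energy_conservation (m : ℕ) (hm : 2 ≤ m)
    (u u' : ℝ → SchwartzMap ℝ ℝ)
    (hu_cont : Continuous u) (hu'_cont : Continuous u')
    (hderiv : ∀ t x : ℝ, HasDerivAt (fun s : ℝ => u s x) (u' t x) t)
    (hPDE : ∀ t x : ℝ, ∃ A : ℝ,
      HilbertPVR (deriv (deriv ⇑(u t))) x A ∧
      u' t x = A - (u t x) ^ (m - 1) * deriv (⇑(u t)) x)
    (Hux : ℝ → ℝ → ℝ)
    (hHux : ∀ t x : ℝ, HilbertPVR (deriv ⇑(u t)) x (Hux t x)) :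
    ∀ t₁ t₂ : ℝ,
      (1 / 2) * (∫ x : ℝ, u t₁ x * Hux t₁ x) -
          (1 / ((m : ℝ) * ((m : ℝ) + 1))) * ∫ x : ℝ, (u t₁ x) ^ (m + 1) =
      (1 / 2) * (∫ x : ℝ, u t₂ x * Hux t₂ x) -
          (1 / ((m : ℝ) * ((m : ℝ) + 1))) * ∫ x : ℝ, (u t₂ x) ^ (m + 1) := by
  have hm0 : (m : ℝ) ≠ 0 := by positivity
  have hcoe (f : SchwartzMap ℝ ℝ) : deriv f = schwartzDeriv f :=
    funext fun x => (SchwartzMap.derivCLM_apply ℝ f x).symm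
  have hH (t x : ℝ) :
      Hux t x = 1 / Real.pi * logConv (schwartzDeriv (schwartzDeriv (u t))) x := by
    refine (hHux t x).unique ?_
    rw [hcoe]
    exact hilbertPVR_schwartz _ x
  have hu' (t x : ℝ) : u' t x =
      1 / Real.pi * logConv (schwartzDeriv (schwartzDeriv (schwartzDeriv (u t)))) x -
        u t x ^ (m - 1) * schwartzDeriv (u t) x := by
    obtain ⟨A, hA, h⟩ := hPDE t x
    rw [hcoe, hcoe] at hA
    rw [hcoe, hA.unique (hilbertPVR_schwartz _ x)] at h
    exact h
  have hflux (s : ℝ) : ∫ x, u' s x * (1 / Real.pi *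
      logConv (schwartzDeriv (schwartzDeriv (u s))) x - u s x ^ m / m) = 0 := by
    refine integral_deriv_mul_self_eq_zero (fun x => ?_) ?_ ?_
    · rw [hu']
      refine ((hasDerivAt_logConv (schwartzDeriv (schwartzDeriv (u s))) x).const_mul _).sub ?_
      refine (((hasDerivAt_schwartz (u s) x).fun_pow m).div_const (m : ℝ)).congr_deriv ?_
      field_simp
    · simp_rw [mul_sub]
      refine (Integrable.congr ((integrable_mul_logConv_schwartzDeriv (u' s)
        (schwartzDeriv (u s))).const_mul (1 / Real.pi)) (.of_forall fun x => ?_)).sub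
        (Integrable.congr ((integrable_pow_mul (u s) (u' s) m).div_const (m : ℝ))
          (.of_forall fun x => ?_)) <;> ring
    · have hpow : Tendsto (fun x => u s x ^ m / m) (cocompact ℝ) (nhds 0) := by
        have h := ((zero_at_infty (u s)).pow m).div_const (m : ℝ)
        rwa [zero_pow (by lia), zero_div] at h
      simpa using ((tendsto_logConv_schwartzDeriv (schwartzDeriv (u s))).const_mul
        (1 / Real.pi)).sub hpow
  have hE (s : ℝ) : HasDerivAt (fun t =>
      1 / 2 * (1 / Real.pi * ∫ x, u t x * logConv (schwartzDeriv (schwartzDeriv (u t))) x) -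
        1 / ((m : ℝ) * ((m : ℝ) + 1)) * ∫ x, u t x ^ (m + 1)) 0 s := by
    refine ((((hasDerivAt_integral_mul_logConv hu_cont hu'_cont hderiv s).const_mul
      (1 / Real.pi)).const_mul (1 / 2)).sub
        ((hasDerivAt_integral_pow hu_cont hu'_cont hderiv m s).const_mul _)).congr_deriv ?_
    have hm1 : (m : ℝ) + 1 ≠ 0 := by positivity
    rw [← hflux s]
    simp_rw [← integral_const_mul]
    rw [← integral_sub]
    · congr with x
      field_simp
    · have h := (integrable_mul_logConv_schwartzDeriv (u' s) (schwartzDeriv (u s))).const_mul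
        (1 / Real.pi)
      exact h.congr (.of_forall fun x => by ring)
    · have h := (integrable_pow_mul (u s) (u' s) m).const_mul
        (1 / ((m : ℝ) * ((m : ℝ) + 1)) * ((m : ℝ) + 1))
      exact h.congr (.of_forall fun x => by ring)
  simp_rw [hH, mul_left_comm _ (1 / Real.pi), integral_const_mul]
  exact is_const_of_deriv_eq_zero (fun s => (hE s).differentiableAt) fun s => (hE s).deriv
end

section
/- Pohozaev identity II for gBO ground states: let m ≥ 2 be an integer and let Q : ℝ → ℝ be continuously differentiable such that for some C > 0 one has |Q(x)| ≤ C/(1+x²) and |Q′(x)| ≤ C/(1+|x|)³ for all x, for every x the principal value H Q′(x) exists, the function x ↦ H Q′(x) is continuous with |H Q′(x)| ≤ C/(1+x²), and −Q(x) − H Q′(x) + Q(x)^m/m = 0 for all x ∈ ℝ. Then ∫_ℝ Q(x) · (H Q′)(x) dx = ((m−1)/2) ∫_ℝ Q(x)² dx. (The left side equals the square of the L² norm of (H ∂_x)^{1/2} Q.) -/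
open MeasureTheory Filter

/-- The conjugate Poisson kernel, up to the factor `1 / π`. -/
noncomputable def conjPoisson (y t : ℝ) : ℝ := t / (t ^ 2 + y ^ 2)

lemma continuous_conjPoisson {y : ℝ} (hy : 0 < y) : Continuous (conjPoisson y) := by
  unfold conjPoisson
  exact continuous_id.div (by fun_prop) fun t => by positivity

lemma abs_conjPoisson_le {y : ℝ} (hy : 0 < y) (t : ℝ) : |conjPoisson y t| ≤ y⁻¹ := by
  unfold conjPoisson
  rw [abs_div, abs_of_pos (by positivity : 0 < t ^ 2 + y ^ 2), div_le_iff₀ (by positivity),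
    ← sq_abs t, inv_mul_eq_div, le_div_iff₀ hy]
  nlinarith [sq_nonneg (|t| - y), sq_nonneg |t|, sq_nonneg y]

lemma abs_conjPoisson_le_inv_abs (y t : ℝ) : |conjPoisson y t| ≤ |t|⁻¹ := by
  unfold conjPoisson
  rcases eq_or_ne t 0 with rfl | ht
  · simp
  · have := abs_pos.2 ht
    rw [abs_div, abs_of_pos (by positivity : 0 < t ^ 2 + y ^ 2), div_le_iff₀ (by positivity),
      ← sq_abs t]
    field_simp
    nlinarith [sq_nonneg y]

lemma integrable_conjPoisson_sq {y : ℝ} (hy : 0 < y) :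
    Integrable fun t => conjPoisson y t ^ 2 := by
  refine ((integrable_inv_one_add_sq.comp_div hy.ne').const_mul (y ^ 2)⁻¹).mono'
    ((continuous_conjPoisson hy).pow 2).aestronglyMeasurable (ae_of_all _ fun t => ?_)
  rw [Real.norm_of_nonneg (sq_nonneg _), conjPoisson]
  have h : (y ^ 2)⁻¹ * (1 + (t / y) ^ 2)⁻¹ = (t ^ 2 + y ^ 2) / (t ^ 2 + y ^ 2) ^ 2 := by
    field_simp
    ring
  rw [h, div_pow]
  gcongr
  nlinarith [sq_nonneg y]

lemma tendsto_conjPoisson_cocompact (y : ℝ) :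
    Tendsto (conjPoisson y) (cocompact ℝ) (nhds 0) := by
  refine squeeze_zero_norm (abs_conjPoisson_le_inv_abs y) ?_
  exact tendsto_inv_atTop_zero.comp (tendsto_norm_cocompact_atTop (E := ℝ))

lemma tendsto_inv_sq_add_sq_cocompact (y : ℝ) :
    Tendsto (fun t : ℝ => (t ^ 2 + y ^ 2)⁻¹) (cocompact ℝ) (nhds 0) := by
  refine tendsto_inv_atTop_zero.comp (tendsto_atTop_add_const_right _ _ ?_)
  exact ((tendsto_pow_atTop two_ne_zero).comp
    (tendsto_norm_cocompact_atTop (E := ℝ))).congr fun t => sq_abs t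

lemma tendsto_log_sub_log_cocompact {y : ℝ} (hy : 0 < y) (a : ℝ) :
    Tendsto (fun x : ℝ => Real.log (x ^ 2 + y ^ 2) - Real.log ((x - a) ^ 2 + y ^ 2))
      (cocompact ℝ) (nhds 0) := by
  have hsub : Tendsto (fun x : ℝ => x - a) (cocompact ℝ) (cocompact ℝ) :=
    (Homeomorph.subRight a).isClosedEmbedding.tendsto_cocompact
  have h := ((tendsto_conjPoisson_cocompact y).comp hsub).const_mul (2 * a)
  have h' := ((tendsto_inv_sq_add_sq_cocompact y).comp hsub).const_mul (a ^ 2)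
  have h1 := ((h.add h').const_add 1).log (by norm_num)
  simp only [mul_zero, add_zero, Real.log_one] at h1
  refine h1.congr fun x => ?_
  rw [← Real.log_div (by positivity) (by positivity)]
  congr 1
  simp only [Function.comp, conjPoisson]
  field_simp
  ring

lemma integrable_conjPoisson_mul {y : ℝ} (hy : 0 < y) (s t : ℝ) :
    Integrable fun x => conjPoisson y (x - t) * conjPoisson y (x - s) := by
  have hk := continuous_conjPoisson hy
  refine (((integrable_conjPoisson_sq hy).comp_sub_right t).add
    ((integrable_conjPoisson_sq hy).comp_sub_right s)).mono'
    (by fun_prop) (ae_of_all _ fun x => ?_)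
  simp only [Real.norm_eq_abs, Pi.add_apply, abs_le]
  constructor <;>
  nlinarith [sq_nonneg (conjPoisson y (x - t) - conjPoisson y (x - s)),
    sq_nonneg (conjPoisson y (x - t) + conjPoisson y (x - s))]

lemma integral_conjPoisson_mul {y : ℝ} (hy : 0 < y) {s t : ℝ} (hst : s ≠ t) :
    ∫ x, conjPoisson y (x - t) * conjPoisson y (x - s)
      = 2 * Real.pi * y / ((t - s) ^ 2 + 4 * y ^ 2) := by
  have hshift := integral_sub_right_eq_self (μ := volume)
    (fun x => conjPoisson y x * conjPoisson y (x - (s - t))) t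
  simp only [sub_sub, add_sub_cancel] at hshift
  rw [hshift]
  have hint := integrable_conjPoisson_mul hy (s - t) 0
  simp only [sub_zero] at hint
  have ha : s - t ≠ 0 := sub_ne_zero.2 hst
  rw [← neg_sq (t - s), neg_sub]
  generalize s - t = a at *
  set A := -(a ^ 2 + 2 * y ^ 2) / (a * (a ^ 2 + 4 * y ^ 2)) with hA
  set B := y / (a ^ 2 + 4 * y ^ 2) with hB
  have hderiv : ∀ x : ℝ, HasDerivAt (fun x : ℝ =>
      A / 2 * (Real.log (x ^ 2 + y ^ 2) - Real.log ((x - a) ^ 2 + y ^ 2))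
        + B * (Real.arctan (x / y) + Real.arctan ((x - a) / y)))
      (conjPoisson y x * conjPoisson y (x - a)) x := by
    intro x
    have e1 : HasDerivAt (fun x : ℝ => x ^ 2 + y ^ 2) (2 * x) x := by
      simpa using ((hasDerivAt_id x).pow 2).add_const (y ^ 2)
    have e2 : HasDerivAt (fun x : ℝ => (x - a) ^ 2 + y ^ 2) (2 * (x - a)) x := by
      simpa using (((hasDerivAt_id x).sub_const a).pow 2).add_const (y ^ 2)
    have e3 : HasDerivAt (fun x : ℝ => x / y) (1 / y) x := (hasDerivAt_id x).div_const y
    have e4 : HasDerivAt (fun x : ℝ => (x - a) / y) (1 / y) x :=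
      ((hasDerivAt_id x).sub_const a).div_const y
    refine ((((e1.log (by positivity)).sub (e2.log (by positivity))).const_mul (A / 2)).add
      ((e3.arctan.add e4.arctan).const_mul B)).congr_deriv ?_
    rw [hA, hB]
    unfold conjPoisson
    have h1 : x ^ 2 + y ^ 2 ≠ 0 := by positivity
    have h2 : (x - a) ^ 2 + y ^ 2 ≠ 0 := by positivity
    have h3 : 1 + (x / y) ^ 2 = (x ^ 2 + y ^ 2) / y ^ 2 := by field_simp; ring
    have h4 : 1 + ((x - a) / y) ^ 2 = ((x - a) ^ 2 + y ^ 2) / y ^ 2 := by field_simp; ring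
    rw [h3, h4]
    field_simp
    ring
  have hlog := (tendsto_log_sub_log_cocompact hy a).const_mul (A / 2)
  have htop : Tendsto (fun x : ℝ => Real.arctan (x / y) + Real.arctan ((x - a) / y)) atTop
      (nhds (Real.pi / 2 + Real.pi / 2)) := by
    have h := Real.tendsto_arctan_atTop.mono_right nhdsWithin_le_nhds
    exact (h.comp (tendsto_id.atTop_div_const hy)).add
      (h.comp ((tendsto_atTop_add_const_right _ (-a) tendsto_id).atTop_div_const hy))
  have hbot : Tendsto (fun x : ℝ => Real.arctan (x / y) + Real.arctan ((x - a) / y)) atBot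
      (nhds (-(Real.pi / 2) + -(Real.pi / 2))) := by
    have h := Real.tendsto_arctan_atBot.mono_right nhdsWithin_le_nhds
    exact (h.comp (tendsto_id.atBot_div_const hy)).add
      (h.comp ((tendsto_atBot_add_const_right _ (-a) tendsto_id).atBot_div_const hy))
  rw [integral_of_hasDerivAt_of_tendsto hderiv hint
    ((hlog.mono_left atBot_le_cocompact).add (hbot.const_mul B))
    ((hlog.mono_left atTop_le_cocompact).add (htop.const_mul B)), hB]
  ring

lemma integral_inv_sq_add_four_sq {y : ℝ} (hy : 0 < y) (t : ℝ) :
    Integrable (fun s => 2 * Real.pi * y / ((t - s) ^ 2 + 4 * y ^ 2)) ∧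
      ∫ s, 2 * Real.pi * y / ((t - s) ^ 2 + 4 * y ^ 2) = Real.pi ^ 2 := by
  have h : ∀ s, 2 * Real.pi * y / ((t - s) ^ 2 + 4 * y ^ 2)
      = Real.pi / (2 * y) * (1 + ((t - s) / (2 * y)) ^ 2)⁻¹ := fun s => by
    field_simp
    ring
  simp only [h]
  refine ⟨((integrable_inv_one_add_sq.comp_div (by positivity)).comp_sub_left t).const_mul _, ?_⟩
  rw [integral_const_mul,
    integral_sub_left_eq_self (fun s => (1 + (s / (2 * y)) ^ 2)⁻¹) volume t,
    Measure.integral_comp_div (fun s => (1 + s ^ 2)⁻¹), integral_univ_inv_one_add_sq,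
    abs_of_pos (by positivity), smul_eq_mul]
  field_simp

lemma integrable_mul_conjPoisson_mul {g : ℝ → ℝ} (hg : Continuous g) (hgi : Integrable g)
    {y : ℝ} (hy : 0 < y) :
    Integrable (fun p : ℝ × (ℝ × ℝ) => (g p.2.1 * conjPoisson y (p.1 - p.2.1)) *
      (g p.2.2 * conjPoisson y (p.1 - p.2.2))) (volume.prod volume) := by
  have hk := continuous_conjPoisson hy
  have hcont : Continuous (fun p : ℝ × (ℝ × ℝ) => (g p.2.1 * conjPoisson y (p.1 - p.2.1)) *
      (g p.2.2 * conjPoisson y (p.1 - p.2.2))) := by fun_prop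
  have hsec : ∀ q : ℝ × ℝ, Integrable fun x => (g q.1 * conjPoisson y (x - q.1)) *
      (g q.2 * conjPoisson y (x - q.2)) := fun q =>
    ((integrable_conjPoisson_mul hy q.2 q.1).const_mul (g q.1 * g q.2)).congr
      (ae_of_all _ fun x => by ring)
  refine (integrable_prod_iff' hcont.aestronglyMeasurable).2 ⟨ae_of_all _ hsec, ?_⟩
  have hdom : Integrable (fun q : ℝ × ℝ => (|g q.1| * |g q.2|) *
      (2 * ∫ x, conjPoisson y x ^ 2)) := (hgi.abs.mul_prod hgi.abs).mul_const _
  refine hdom.mono' hcont.aestronglyMeasurable.norm.prod_swap.integral_prod_right'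
    (ae_of_all _ fun q => ?_)
  rw [Real.norm_of_nonneg (integral_nonneg fun _ => norm_nonneg _)]
  have i1 := (integrable_conjPoisson_sq hy).comp_sub_right q.1
  have i2 := (integrable_conjPoisson_sq hy).comp_sub_right q.2
  have hle : ∫ x, ‖(g q.1 * conjPoisson y (x - q.1)) * (g q.2 * conjPoisson y (x - q.2))‖
      ≤ ∫ x, |g q.1| * |g q.2| * (conjPoisson y (x - q.1) ^ 2 + conjPoisson y (x - q.2) ^ 2) := by
    refine integral_mono (hsec q).norm ((i1.add i2).const_mul _) fun x => ?_
    simp only [norm_mul, Real.norm_eq_abs]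
    have h : |conjPoisson y (x - q.1)| * |conjPoisson y (x - q.2)|
        ≤ conjPoisson y (x - q.1) ^ 2 + conjPoisson y (x - q.2) ^ 2 := by
      rw [← sq_abs (conjPoisson y (x - q.1)), ← sq_abs (conjPoisson y (x - q.2))]
      nlinarith [sq_nonneg (|conjPoisson y (x - q.1)| - |conjPoisson y (x - q.2)|),
        sq_nonneg (|conjPoisson y (x - q.1)| + |conjPoisson y (x - q.2)|)]
    calc _ = |g q.1| * |g q.2| *
          (|conjPoisson y (x - q.1)| * |conjPoisson y (x - q.2)|) := by ring
      _ ≤ _ := by gcongr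
  refine hle.trans_eq ?_
  rw [integral_const_mul, integral_add i1 i2,
    integral_sub_right_eq_self (fun x => conjPoisson y x ^ 2),
    integral_sub_right_eq_self (fun x => conjPoisson y x ^ 2)]
  ring

/-- Convolution with the conjugate Poisson kernels is bounded in `L²`, uniformly in `y`. -/
lemma integral_conjPoisson_conv_sq_le {g : ℝ → ℝ} (hg : Continuous g) (hgi : Integrable g)
    {M : ℝ} (hM : ∀ x, |g x| ≤ M) {y : ℝ} (hy : 0 < y) :
    Integrable (fun x => (∫ t, g t * conjPoisson y (x - t)) ^ 2) ∧
      ∫ x, (∫ t, g t * conjPoisson y (x - t)) ^ 2 ≤ M * Real.pi ^ 2 * ∫ t, |g t| := by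
  have hF := integrable_mul_conjPoisson_mul hg hgi hy
  have hsq : ∀ x, ∫ q : ℝ × ℝ, (g q.1 * conjPoisson y (x - q.1)) *
      (g q.2 * conjPoisson y (x - q.2)) = (∫ t, g t * conjPoisson y (x - t)) ^ 2 := fun x => by
    rw [sq]
    exact integral_prod_mul (fun t => g t * conjPoisson y (x - t))
      (fun t => g t * conjPoisson y (x - t))
  refine ⟨hF.integral_prod_left.congr (ae_of_all _ hsq), ?_⟩
  simp only [← hsq]
  rw [integral_integral_swap hF]
  have hR := hF.integral_prod_right
  have hprod := integral_prod _ hR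
  refine (le_abs_self _).trans ?_
  rw [← Real.norm_eq_abs]
  erw [hprod]
  rw [← integral_const_mul]
  refine norm_integral_le_of_norm_le (hgi.abs.const_mul _) (ae_of_all _ fun t => ?_)
  obtain ⟨hi, hv⟩ := integral_inv_sq_add_four_sq hy t
  have hv' : M * Real.pi ^ 2 * |g t|
      = ∫ s, M * |g t| * (2 * Real.pi * y / ((t - s) ^ 2 + 4 * y ^ 2)) := by
    rw [integral_const_mul, hv]
    ring
  rw [hv']
  refine norm_integral_le_of_norm_le (hi.const_mul _) ?_
  filter_upwards [Measure.ae_ne volume t] with s hs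
  have : ∀ x, (g t * conjPoisson y (x - t)) * (g s * conjPoisson y (x - s))
      = g t * g s * (conjPoisson y (x - t) * conjPoisson y (x - s)) := fun x => by ring
  simp only [this]
  rw [integral_const_mul, integral_conjPoisson_mul hy hs, norm_mul, norm_mul, Real.norm_eq_abs,
    Real.norm_eq_abs, Real.norm_of_nonneg (by positivity), mul_comm M]
  gcongr
  exact hM s

/-- The difference between the conjugate Poisson kernel and the truncated Hilbert kernel. -/
noncomputable def kernelGap (y t : ℝ) : ℝ := conjPoisson y t - if y < |t| then t⁻¹ else 0

lemma kernelGap_neg (y t : ℝ) : kernelGap y (-t) = -kernelGap y t := by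
  unfold kernelGap conjPoisson
  rw [abs_neg]
  split_ifs <;> simp [neg_div, inv_neg, sub_eq_add_neg, add_comm]

lemma kernelGap_mul {y : ℝ} (hy : 0 < y) (s : ℝ) : kernelGap y (y * s) = y⁻¹ * kernelGap 1 s := by
  unfold kernelGap conjPoisson
  have h : y < |y * s| ↔ 1 < |s| := by
    rw [abs_mul, abs_of_pos hy]
    exact lt_mul_iff_one_lt_right hy
  have h' : y * s / ((y * s) ^ 2 + y ^ 2) = y⁻¹ * (s / (s ^ 2 + 1 ^ 2)) := by
    field_simp
  rw [h']
  by_cases hs : 1 < |s|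
  · rw [if_pos (h.2 hs), if_pos hs, mul_inv]
    ring
  · rw [if_neg (mt h.1 hs), if_neg hs]
    ring

lemma abs_kernelGap_one_le (s : ℝ) : |kernelGap 1 s| ≤ (1 + s ^ 2)⁻¹ := by
  unfold kernelGap conjPoisson
  split_ifs with h
  · have hs : s ≠ 0 := fun h0 => by norm_num [h0] at h
    have : s / (s ^ 2 + 1 ^ 2) - s⁻¹ = -(s⁻¹ * (1 + s ^ 2)⁻¹) := by
      field_simp
      ring
    rw [this, abs_neg, abs_mul, abs_of_pos (by positivity : 0 < (1 + s ^ 2)⁻¹), abs_inv]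
    exact mul_le_of_le_one_left (by positivity) (inv_le_one_of_one_le₀ h.le)
  · rw [sub_zero, abs_div, abs_of_pos (by positivity : 0 < s ^ 2 + 1 ^ 2), div_eq_mul_inv,
      one_pow, add_comm]
    exact mul_le_of_le_one_left (by positivity) (not_lt.1 h)

lemma measurable_kernelGap (y : ℝ) : Measurable (kernelGap y) := by
  unfold kernelGap conjPoisson
  refine Measurable.sub (by fun_prop) (Measurable.ite ?_ (by fun_prop) measurable_const)
  exact measurableSet_lt measurable_const (by fun_prop)

lemma integral_kernelGap (y : ℝ) : ∫ s, kernelGap y s = 0 := by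
  have h := integral_neg_eq_self (kernelGap y) volume
  simp only [kernelGap_neg, integral_neg] at h
  linarith

lemma integrable_mul_conjPoisson {g : ℝ → ℝ} (hgi : Integrable g) {y : ℝ} (hy : 0 < y) (x : ℝ) :
    Integrable fun z => g z * conjPoisson y (x - z) :=
  hgi.mul_bdd (c := y⁻¹)
    ((continuous_conjPoisson hy).comp
      (by fun_prop : Continuous fun z : ℝ => x - z)).aestronglyMeasurable
    (ae_of_all _ fun z => abs_conjPoisson_le hy (x - z))

lemma conjPoisson_conv_sub_truncated {g : ℝ → ℝ} (hgi : Integrable g)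
    {y : ℝ} (hy : 0 < y) (x : ℝ) :
    (∫ z, g z * conjPoisson y (x - z)) - ∫ z in {z : ℝ | y < |x - z|}, g z / (x - z)
      = ∫ s, g (x - y * s) * kernelGap 1 s := by
  have hms : MeasurableSet {z : ℝ | y < |x - z|} :=
    measurableSet_lt measurable_const (by fun_prop)
  have hI : ∀ z, Set.indicator {z : ℝ | y < |x - z|} (fun z => g z / (x - z)) z
      = g z * if y < |x - z| then (x - z)⁻¹ else 0 := fun z => by
    simp only [Set.indicator_apply, Set.mem_ofPred_eq, div_eq_mul_inv]
    split_ifs <;> simp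
  have h2 : Integrable fun z => g z * if y < |x - z| then (x - z)⁻¹ else 0 := by
    refine hgi.mul_bdd (c := y⁻¹)
      (Measurable.ite hms (by fun_prop) measurable_const).aestronglyMeasurable
      (ae_of_all _ fun z => ?_)
    split_ifs with h
    · rw [norm_inv, Real.norm_eq_abs]
      exact inv_anti₀ hy h.le
    · simpa using hy.le
  rw [← integral_indicator hms, integral_congr_ae (ae_of_all _ hI),
    ← integral_sub (integrable_mul_conjPoisson hgi hy x) h2]
  have h3 := integral_sub_left_eq_self (fun z => g z * conjPoisson y (x - z) -
    g z * if y < |x - z| then (x - z)⁻¹ else 0) volume x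
  have h4 := Measure.integral_comp_mul_left (fun t => g (x - t) * kernelGap y t) y
  simp only [sub_sub_cancel, ← mul_sub] at h3
  simp only [← mul_sub]
  rw [← h3]
  simp only [kernelGap_mul hy, mul_left_comm _ y⁻¹, integral_const_mul, smul_eq_mul,
    abs_of_pos (inv_pos.2 hy)] at h4
  exact (mul_left_cancel₀ (inv_ne_zero hy.ne') h4).symm

/-- The conjugate Poisson integrals converge to the principal value Hilbert transform wherever
the latter exists. -/
lemma HilbertPVR.tendsto_conjPoisson {g : ℝ → ℝ} (hg : Continuous g) (hgi : Integrable g)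
    {M : ℝ} (hM : ∀ x, |g x| ≤ M) {x A : ℝ} (h : HilbertPVR g x A) :
    Tendsto (fun y => ∫ z, g z * conjPoisson y (x - z)) (nhdsWithin 0 (Set.Ioi 0))
      (nhds (Real.pi * A)) := by
  have hgap : Tendsto (fun y => ∫ s, g (x - y * s) * kernelGap 1 s) (nhdsWithin 0 (Set.Ioi 0))
      (nhds (∫ s, g x * kernelGap 1 s)) := by
    refine tendsto_integral_filter_of_dominated_convergence (fun s => M * (1 + s ^ 2)⁻¹)
      (Eventually.of_forall fun y => ?_) (Eventually.of_forall fun y => ae_of_all _ fun s => ?_)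
      (integrable_inv_one_add_sq.const_mul M) (ae_of_all _ fun s => ?_)
    · exact ((hg.comp (by fun_prop)).measurable.mul (measurable_kernelGap 1)).aestronglyMeasurable
    · rw [norm_mul]
      exact mul_le_mul (hM _) (abs_kernelGap_one_le s) (norm_nonneg _)
        ((abs_nonneg _).trans (hM 0))
    · have hc : Continuous fun y : ℝ => g (x - y * s) * kernelGap 1 s := by fun_prop
      simpa using (hc.tendsto 0).mono_left nhdsWithin_le_nhds
  rw [integral_const_mul, integral_kernelGap, mul_zero] at hgap
  have h1 := (h.const_mul Real.pi).add hgap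
  rw [add_zero] at h1
  refine h1.congr' ?_
  filter_upwards [self_mem_nhdsWithin] with y hy
  rw [← conjPoisson_conv_sub_truncated hgi hy x, ← mul_assoc,
    mul_one_div_cancel Real.pi_ne_zero, one_mul, add_sub_cancel]

lemma abs_mul_conjPoisson_le_one (y t : ℝ) : |t * conjPoisson y t| ≤ 1 := by
  unfold conjPoisson
  rw [← mul_div_assoc, ← sq, abs_of_nonneg (by positivity)]
  exact div_le_one_of_le₀ (le_add_of_nonneg_right (sq_nonneg y)) (by positivity)

lemma tendsto_mul_conjPoisson {t : ℝ} (ht : t ≠ 0) :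
    Tendsto (fun y => t * conjPoisson y t) (nhds 0) (nhds 1) := by
  have hc : ContinuousAt (fun y : ℝ => t * (t / (t ^ 2 + y ^ 2))) 0 := by
    refine continuousAt_const.mul (continuousAt_const.div (by fun_prop) ?_)
    simpa using ht
  have h1 : t * (t / (t ^ 2 + 0 ^ 2)) = 1 := by
    field_simp
    simp
  simpa only [conjPoisson, h1] using hc.tendsto

lemma integral_id_mul_conjPoisson_conv {g : ℝ → ℝ} (hgi : Integrable g)
    (hw : Integrable fun x => x * g x) {y : ℝ} (hy : 0 < y) :
    2 * ∫ x, x * g x * ∫ z, g z * conjPoisson y (x - z)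
      = ∫ x, g x * ∫ z, g z * ((x - z) * conjPoisson y (x - z)) := by
  have hk := continuous_conjPoisson hy
  have hI : Integrable (fun p : ℝ × ℝ => p.1 * g p.1 * g p.2 * conjPoisson y (p.1 - p.2)) :=
    (hw.mul_prod hgi).mul_bdd (c := y⁻¹)
      (by fun_prop : Continuous fun p : ℝ × ℝ => conjPoisson y (p.1 - p.2)).aestronglyMeasurable
      (ae_of_all _ fun p => abs_conjPoisson_le hy _)
  have hodd : ∀ t, conjPoisson y (-t) = -conjPoisson y t := fun t => by
    simp [conjPoisson, neg_div]
  have hJ : Integrable (fun p : ℝ × ℝ => p.2 * g p.2 * g p.1 * conjPoisson y (p.2 - p.1)) :=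
    hI.swap
  have hswap : ∫ p : ℝ × ℝ, p.2 * g p.2 * g p.1 * conjPoisson y (p.2 - p.1)
      = ∫ p : ℝ × ℝ, p.1 * g p.1 * g p.2 * conjPoisson y (p.1 - p.2) :=
    integral_prod_swap (fun p : ℝ × ℝ => p.1 * g p.1 * g p.2 * conjPoisson y (p.1 - p.2))
  have hsum : ∀ p : ℝ × ℝ, p.1 * g p.1 * g p.2 * conjPoisson y (p.1 - p.2) +
      p.2 * g p.2 * g p.1 * conjPoisson y (p.2 - p.1)
      = g p.1 * (g p.2 * ((p.1 - p.2) * conjPoisson y (p.1 - p.2))) := fun p => by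
    rw [← neg_sub p.1 p.2, hodd]
    ring
  have hK := (hI.add hJ).congr (ae_of_all _ hsum)
  have hA : ∫ p : ℝ × ℝ, p.1 * g p.1 * g p.2 * conjPoisson y (p.1 - p.2)
      = ∫ x, x * g x * ∫ z, g z * conjPoisson y (x - z) := by
    refine (integral_prod _ hI).trans ?_
    simp only [mul_assoc, integral_const_mul]
  have hB : ∫ p : ℝ × ℝ, g p.1 * (g p.2 * ((p.1 - p.2) * conjPoisson y (p.1 - p.2)))
      = ∫ x, g x * ∫ z, g z * ((x - z) * conjPoisson y (x - z)) := by
    refine (integral_prod _ hK).trans ?_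
    simp only [integral_const_mul]
  rw [← hA, ← hB, ← integral_congr_ae (ae_of_all _ hsum), integral_add hI hJ, hswap]
  ring

lemma tendsto_integral_id_mul_conjPoisson_conv {g : ℝ → ℝ} (hg : Continuous g)
    (hgi : Integrable g) (hw : Integrable fun x => x * g x) :
    Tendsto (fun y => ∫ x, x * g x * ∫ z, g z * conjPoisson y (x - z))
      (nhdsWithin 0 (Set.Ioi 0)) (nhds ((∫ x, g x) ^ 2 / 2)) := by
  have hbound : ∀ y x z : ℝ, ‖g z * ((x - z) * conjPoisson y (x - z))‖ ≤ |g z| := fun y x z => by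
    rw [norm_mul]
    exact mul_le_of_le_one_right (norm_nonneg _) (abs_mul_conjPoisson_le_one y (x - z))
  have hcont : ∀ y > 0, Continuous fun p : ℝ × ℝ =>
      g p.2 * ((p.1 - p.2) * conjPoisson y (p.1 - p.2)) := fun y hy => by
    have := continuous_conjPoisson hy
    fun_prop
  have hinner : ∀ x, Tendsto (fun y => ∫ z, g z * ((x - z) * conjPoisson y (x - z)))
      (nhdsWithin 0 (Set.Ioi 0)) (nhds (∫ z, g z)) := fun x => by
    refine tendsto_integral_filter_of_dominated_convergence (fun z => |g z|) ?_
      (Eventually.of_forall fun y => ae_of_all _ (hbound y x)) hgi.abs ?_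
    · filter_upwards [self_mem_nhdsWithin] with y hy
      exact ((hcont y hy).comp (by fun_prop : Continuous fun z : ℝ => (x, z))).aestronglyMeasurable
    · filter_upwards [Measure.ae_ne volume x] with z hz
      simpa using ((tendsto_mul_conjPoisson (sub_ne_zero.2 hz.symm)).mono_left
        nhdsWithin_le_nhds).const_mul (g z)
  have houter : Tendsto (fun y => ∫ x, g x * ∫ z, g z * ((x - z) * conjPoisson y (x - z)))
      (nhdsWithin 0 (Set.Ioi 0)) (nhds (∫ x, g x * ∫ z, g z)) := by
    refine tendsto_integral_filter_of_dominated_convergence (fun x => |g x| * ∫ z, |g z|) ?_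
      (Eventually.of_forall fun y => ae_of_all _ fun x => ?_) (hgi.abs.mul_const _)
      (ae_of_all _ fun x => (hinner x).const_mul (g x))
    · filter_upwards [self_mem_nhdsWithin] with y hy
      exact hg.aestronglyMeasurable.mul
        (hcont y hy).aestronglyMeasurable.integral_prod_right'
    · rw [norm_mul]
      gcongr
      · rfl
      · exact norm_integral_le_of_norm_le hgi.abs (ae_of_all _ (hbound y x))
  rw [integral_mul_const, ← sq] at houter
  refine (houter.div_const 2).congr' ?_
  filter_upwards [self_mem_nhdsWithin] with y hy
  rw [← integral_id_mul_conjPoisson_conv hgi hw hy]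
  ring

/-- A family that is bounded in `L²` and converges pointwise to zero converges weakly to zero. -/
lemma tendsto_integral_mul_zero_of_bounded_sq {α ι : Type*} [MeasurableSpace α] {μ : Measure α}
    {l : Filter ι} [l.IsCountablyGenerated] {w : α → ℝ} {d : ι → α → ℝ} {B : ℝ}
    (hw : AEStronglyMeasurable w μ) (hw2 : Integrable (fun x => w x ^ 2) μ)
    (hd : ∀ᶠ i in l, AEStronglyMeasurable (d i) μ)
    (hd2 : ∀ᶠ i in l, Integrable (fun x => d i x ^ 2) μ)
    (hB : ∀ᶠ i in l, ∫ x, d i x ^ 2 ∂μ ≤ B)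
    (hlim : ∀ᵐ x ∂μ, Tendsto (fun i => d i x) l (nhds 0)) :
    Tendsto (fun i => ∫ x, w x * d i x ∂μ) l (nhds 0) := by
  rw [Metric.tendsto_nhds]
  intro ε hε
  obtain ⟨K, hK, hKB⟩ : ∃ K > 0, B / K < ε / 2 := by
    refine ⟨2 * (|B| + 1) / ε, by positivity, ?_⟩
    rw [div_lt_iff₀ (by positivity)]
    have : ε / 2 * (2 * (|B| + 1) / ε) = |B| + 1 := by field_simp
    linarith [le_abs_self B]
  have hmeas : ∀ᶠ i in l, AEStronglyMeasurable (fun x => min |w x * d i x| (K * w x ^ 2)) μ := by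
    filter_upwards [hd] with i hi
    exact (continuous_abs.comp_aestronglyMeasurable (hw.mul hi)).inf ((hw.pow 2).const_mul K)
  have hbd : ∀ i x, ‖min |w x * d i x| (K * w x ^ 2)‖ ≤ K * w x ^ 2 := fun i x => by
    rw [Real.norm_of_nonneg (le_min (abs_nonneg _) (by positivity))]
    exact min_le_right _ _
  have hmin : Tendsto (fun i => ∫ x, min |w x * d i x| (K * w x ^ 2) ∂μ) l
      (nhds (∫ _, (0 : ℝ) ∂μ)) := by
    refine tendsto_integral_filter_of_dominated_convergence (fun x => K * w x ^ 2) hmeas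
      (Eventually.of_forall fun i => ae_of_all _ (hbd i)) (hw2.const_mul K) ?_
    filter_upwards [hlim] with x hx
    have h1 : Tendsto (fun i => min |w x * d i x| (K * w x ^ 2)) l
        (nhds (min |w x * 0| (K * w x ^ 2))) := ((hx.const_mul (w x)).abs).min tendsto_const_nhds
    rwa [mul_zero, abs_zero, min_eq_left (by positivity)] at h1
  rw [integral_zero] at hmin
  filter_upwards [hmin.eventually (gt_mem_nhds (half_pos hε)), hmeas, hd2, hB] with i h1 h2 h3 h4
  have i1 := (hw2.const_mul K).mono' h2 (ae_of_all _ (hbd i))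
  have hle : ∀ x, ‖w x * d i x‖ ≤ min |w x * d i x| (K * w x ^ 2) + d i x ^ 2 / K := fun x => by
    rw [Real.norm_eq_abs]
    rcases le_total |w x * d i x| (K * w x ^ 2) with h | h
    · rw [min_eq_left h]
      exact le_add_of_nonneg_right (by positivity)
    · rw [min_eq_right h, abs_mul, ← sq_abs (w x), ← sq_abs (d i x)]
      have : K * |w x| ^ 2 + |d i x| ^ 2 / K - |w x| * |d i x|
          = ((K * |w x| - |d i x| / 2) ^ 2 + 3 / 4 * |d i x| ^ 2) / K := by
        field_simp
        ring
      have h0 : 0 ≤ ((K * |w x| - |d i x| / 2) ^ 2 + 3 / 4 * |d i x| ^ 2) / K := by positivity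
      linarith
  rw [dist_zero_right]
  calc ‖∫ x, w x * d i x ∂μ‖
      ≤ ∫ x, min |w x * d i x| (K * w x ^ 2) + d i x ^ 2 / K ∂μ :=
        norm_integral_le_of_norm_le (i1.add (h3.div_const K)) (ae_of_all _ hle)
    _ = ∫ x, min |w x * d i x| (K * w x ^ 2) ∂μ + (∫ x, d i x ^ 2 ∂μ) / K := by
        rw [integral_add i1 (h3.div_const K), integral_div]
    _ < ε := by
        have : (∫ x, d i x ^ 2 ∂μ) / K ≤ B / K := by gcongr
        linarith

/-- If `∫ g = 0`, then `x g(x)` is orthogonal to the Hilbert transform of `g`. -/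
lemma integral_id_mul_mul_hilbert_eq_zero {g h : ℝ → ℝ} (hg : Continuous g) (hgi : Integrable g)
    {M : ℝ} (hM : ∀ x, |g x| ≤ M) (hw : Integrable fun x => x * g x)
    (hw2 : Integrable fun x => (x * g x) ^ 2) (hg0 : ∫ x, g x = 0)
    (hh : Continuous h) (hh2 : Integrable fun x => h x ^ 2)
    (hwh : Integrable fun x => x * g x * h x)
    (hH : ∀ x, HilbertPVR g x (h x)) :
    ∫ x, x * g x * h x = 0 := by
  set T : ℝ → ℝ → ℝ := fun y x => ∫ z, g z * conjPoisson y (x - z) with hT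
  have hTm : ∀ y > 0, AEStronglyMeasurable (T y) volume := fun y hy => by
    have := continuous_conjPoisson hy
    exact (by fun_prop : Continuous fun p : ℝ × ℝ =>
      g p.2 * conjPoisson y (p.1 - p.2)).aestronglyMeasurable.integral_prod_right'
  have hTle : ∀ y > 0, ∀ x, ‖T y x‖ ≤ ∫ z, |g z| * y⁻¹ := fun y hy x => by
    refine norm_integral_le_of_norm_le (hgi.abs.mul_const _) (ae_of_all _ fun z => ?_)
    rw [norm_mul]
    exact mul_le_mul_of_nonneg_left (abs_conjPoisson_le hy _) (norm_nonneg _)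
  have hpos : ∀ᶠ y : ℝ in nhdsWithin 0 (Set.Ioi 0), 0 < y := self_mem_nhdsWithin
  have hsq_le : ∀ y x, (T y x - Real.pi * h x) ^ 2
      ≤ 2 * T y x ^ 2 + 2 * Real.pi ^ 2 * h x ^ 2 := fun y x => by
    nlinarith [sq_nonneg (T y x + Real.pi * h x)]
  have hdom : ∀ y > 0, Integrable fun x => 2 * T y x ^ 2 + 2 * Real.pi ^ 2 * h x ^ 2 :=
    fun y hy => ((integral_conjPoisson_conv_sq_le hg hgi hM hy).1.const_mul 2).add
      (hh2.const_mul _)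
  have hdm : ∀ y > 0, AEStronglyMeasurable (fun x => T y x - Real.pi * h x) volume :=
    fun y hy => (hTm y hy).sub (hh.const_mul _).aestronglyMeasurable
  have hd2 : ∀ y > 0, Integrable fun x => (T y x - Real.pi * h x) ^ 2 := fun y hy =>
    (hdom y hy).mono' ((hdm y hy).pow 2) (ae_of_all _ fun x => by
      rw [Real.norm_of_nonneg (sq_nonneg _)]
      exact hsq_le y x)
  have hlim := tendsto_integral_mul_zero_of_bounded_sq (μ := volume) (w := fun x => x * g x)
    (d := fun y x => T y x - Real.pi * h x)
    (B := 2 * (M * Real.pi ^ 2 * ∫ t, |g t|) + 2 * Real.pi ^ 2 * ∫ x, h x ^ 2)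
    hw.aestronglyMeasurable hw2 (hpos.mono hdm) (hpos.mono hd2)
    (hpos.mono fun y hy => by
      have hi := integral_conjPoisson_conv_sq_le hg hgi hM hy
      refine (integral_mono (hd2 y hy) (hdom y hy) (hsq_le y)).trans ?_
      rw [integral_add (hi.1.const_mul 2) (hh2.const_mul _), integral_const_mul,
        integral_const_mul]
      have := hi.2
      gcongr)
    (ae_of_all _ fun x => by
      simpa using ((hH x).tendsto_conjPoisson hg hgi hM).sub_const (Real.pi * h x))
  have hlim' := tendsto_integral_id_mul_conjPoisson_conv hg hgi hw
  rw [hg0, zero_pow two_ne_zero, zero_div] at hlim'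
  have hconst : Tendsto (fun _ : ℝ => Real.pi * ∫ x, x * g x * h x)
      (nhdsWithin 0 (Set.Ioi 0)) (nhds (0 - 0)) := by
    refine (hlim'.sub hlim).congr' (hpos.mono fun y hy => ?_)
    have hi : Integrable fun x => x * g x * T y x :=
      hw.mul_bdd (hTm y hy) (ae_of_all _ (hTle y hy))
    have hi' : Integrable fun x => x * g x * (T y x - Real.pi * h x) :=
      (hi.sub (hwh.const_mul Real.pi)).congr (ae_of_all _ fun x => by
        simp only [Pi.sub_apply]
        ring)
    rw [← integral_const_mul, ← integral_sub hi hi']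
    exact integral_congr_ae (ae_of_all _ fun x => by ring)
  have h0 := tendsto_nhds_unique hconst tendsto_const_nhds
  rw [sub_zero] at h0
  exact (mul_eq_zero.1 h0.symm).resolve_left Real.pi_ne_zero

/-- Integration by parts of `x (Q ^ (k + 2))'`. -/
lemma integral_pow_add_mul_integral_id_mul_deriv {Q : ℝ → ℝ} {C : ℝ}
    (hQ : ContDiff ℝ 1 Q) (hQb : ∀ x, |Q x| ≤ C / (1 + x ^ 2))
    (hw : Integrable fun x => x * deriv Q x) (k : ℕ) :
    Integrable (fun x => Q x ^ (k + 2)) ∧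
      Integrable (fun x => x * deriv Q x * Q x ^ (k + 1)) ∧
      ∫ x, Q x ^ (k + 2) = -((k : ℝ) + 2) * ∫ x, x * deriv Q x * Q x ^ (k + 1) := by
  have hC : 0 ≤ C := by simpa using (abs_nonneg _).trans (hQb 0)
  have hQC : ∀ x, |Q x| ≤ C := fun x =>
    (hQb x).trans (div_le_self hC (by nlinarith [sq_nonneg x]))
  have hQi : Integrable Q := (integrable_inv_one_add_sq.const_mul C).mono'
    hQ.continuous.aestronglyMeasurable (ae_of_all _ fun x => by
      simpa [div_eq_mul_inv] using hQb x)
  have hpow : ∀ n : ℕ, ∀ x, ‖Q x ^ n‖ ≤ C ^ n := fun n x => by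
    rw [norm_pow]
    exact pow_le_pow_left₀ (norm_nonneg _) (hQC x) n
  have hi1 : Integrable fun x => Q x ^ (k + 2) := by
    simp only [pow_succ' _ (k + 1)]
    exact hQi.mul_bdd (hQ.continuous.pow _).aestronglyMeasurable (ae_of_all _ (hpow (k + 1)))
  have hi2 : Integrable fun x => x * deriv Q x * Q x ^ (k + 1) :=
    hw.mul_bdd (hQ.continuous.pow _).aestronglyMeasurable (ae_of_all _ (hpow (k + 1)))
  refine ⟨hi1, hi2, ?_⟩
  have hder : ∀ x, HasDerivAt (fun x => x * Q x ^ (k + 2))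
      (Q x ^ (k + 2) + ((k : ℝ) + 2) * (x * deriv Q x * Q x ^ (k + 1))) x := fun x => by
    have h1 := (hQ.differentiable one_ne_zero x).hasDerivAt
    refine ((hasDerivAt_id x).mul (h1.pow (k + 2))).congr_deriv ?_
    simp
    ring
  have hlim : Tendsto (fun x => x * Q x ^ (k + 2)) (cocompact ℝ) (nhds 0) := by
    have h2 : Tendsto (fun x : ℝ => C ^ (k + 2) * (|x|)⁻¹) (cocompact ℝ) (nhds (C ^ (k + 2) * 0)) :=
      (tendsto_inv_atTop_zero.comp (tendsto_norm_cocompact_atTop (E := ℝ))).const_mul _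
    rw [mul_zero] at h2
    refine squeeze_zero_norm (fun x => ?_) h2
    rcases eq_or_ne x 0 with rfl | hx
    · simp
    have hx' := abs_pos.2 hx
    rw [norm_mul, norm_pow, Real.norm_eq_abs, Real.norm_eq_abs]
    have hQx : |Q x| ≤ C * |x|⁻¹ := (hQb x).trans (by
      rw [div_eq_mul_inv]
      gcongr
      rw [← sq_abs]
      nlinarith [sq_nonneg (|x| - 1)])
    calc |x| * |Q x| ^ (k + 2) = |x| * |Q x| * |Q x| * |Q x| ^ k := by ring
      _ ≤ |x| * (C * |x|⁻¹) * (C * |x|⁻¹) * C ^ k := by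
        gcongr
        exact hQC x
      _ = C ^ (k + 2) * |x|⁻¹ := by
        field_simp
        ring
  have h0 := integral_of_hasDerivAt_of_tendsto hder (hi1.add (hi2.const_mul _))
    (hlim.mono_left atBot_le_cocompact) (hlim.mono_left atTop_le_cocompact)
  rw [integral_add hi1 (hi2.const_mul _), integral_const_mul] at h0
  linarith

/-- Pohozaev identity II for gBO ground states:
`∫ Q · (HQ') = ((m-1)/2) ∫ Q²`. -/
theorem gBO_pohozaev_II (m : ℕ) (hm : 2 ≤ m) (Q : ℝ → ℝ)
    (hQ : ContDiff ℝ 1 Q) (C : ℝ) (hC : 0 < C)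
    (hQbound : ∀ x : ℝ, |Q x| ≤ C / (1 + x ^ 2))
    (hQ'bound : ∀ x : ℝ, |deriv Q x| ≤ C / (1 + |x|) ^ 3)
    (HQ' : ℝ → ℝ)
    (hHQ' : ∀ x : ℝ, HilbertPVR (deriv Q) x (HQ' x))
    (hHQ'cont : Continuous HQ')
    (hHQ'bound : ∀ x : ℝ, |HQ' x| ≤ C / (1 + x ^ 2))
    (heq : ∀ x : ℝ, -Q x - HQ' x + (Q x) ^ m / (m : ℝ) = 0) :
    ∫ x : ℝ, Q x * HQ' x = (((m : ℝ) - 1) / 2) * ∫ x : ℝ, (Q x) ^ 2 := by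
  have hg : Continuous (deriv Q) := hQ.continuous_deriv le_rfl
  have hHQ : ∀ x, HQ' x = -Q x + Q x ^ m / m := fun x => by linarith [heq x]
  have hwb : ∀ x, |x * deriv Q x| ≤ C * (1 + x ^ 2)⁻¹ := fun x => by
    have h0 := abs_nonneg x
    rw [abs_mul]
    calc |x| * |deriv Q x| ≤ |x| * (C / (1 + |x|) ^ 3) := by
          gcongr
          exact hQ'bound x
      _ = C * (|x| / (1 + |x|) ^ 3) := by ring
      _ ≤ C * (1 + x ^ 2)⁻¹ := by
          gcongr
          rw [div_le_iff₀ (by positivity), inv_mul_eq_div, le_div_iff₀ (by positivity), ← sq_abs x]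
          nlinarith [pow_nonneg h0 3, pow_nonneg h0 2]
  have hgb : ∀ x, |deriv Q x| ≤ C * (1 + x ^ 2)⁻¹ := fun x => by
    have h0 := abs_nonneg x
    refine (hQ'bound x).trans ?_
    rw [div_eq_mul_inv]
    gcongr
    rw [← sq_abs x]
    nlinarith [pow_nonneg h0 3, pow_nonneg h0 2]
  have hle1 : ∀ x : ℝ, C * (1 + x ^ 2)⁻¹ ≤ C := fun x =>
    mul_le_of_le_one_right hC.le (inv_le_one_of_one_le₀ (by nlinarith [sq_nonneg x]))
  have hdom := integrable_inv_one_add_sq.const_mul C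
  have hgi : Integrable (deriv Q) := hdom.mono' hg.aestronglyMeasurable (ae_of_all _ hgb)
  have hw : Integrable fun x => x * deriv Q x :=
    hdom.mono' (by fun_prop) (ae_of_all _ hwb)
  have hw2 : Integrable fun x => (x * deriv Q x) ^ 2 := by
    simp only [sq]
    exact hw.mul_bdd hw.aestronglyMeasurable (ae_of_all _ fun x => (hwb x).trans (hle1 x))
  have hHb : ∀ x, |HQ' x| ≤ C * (1 + x ^ 2)⁻¹ := fun x => by
    simpa [div_eq_mul_inv] using hHQ'bound x
  have hHi : Integrable HQ' := hdom.mono' hHQ'cont.aestronglyMeasurable (ae_of_all _ hHb)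
  have hH1 : ∀ᵐ x, ‖HQ' x‖ ≤ C := ae_of_all _ fun x => (hHb x).trans (hle1 x)
  have hH2 : Integrable fun x => HQ' x ^ 2 := by
    simp only [sq]
    exact hHi.mul_bdd hHQ'cont.aestronglyMeasurable hH1
  have hQ0 : Tendsto Q (cocompact ℝ) (nhds 0) := by
    have h := (tendsto_inv_sq_add_sq_cocompact 1).const_mul C
    rw [mul_zero] at h
    refine squeeze_zero_norm (fun x => ?_) h
    rw [one_pow, add_comm, ← div_eq_mul_inv]
    exact hQbound x
  have hg0 : ∫ x, deriv Q x = 0 := by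
    simpa using integral_of_hasDerivAt_of_tendsto
      (fun x => (hQ.differentiable one_ne_zero x).hasDerivAt) hgi
      (hQ0.mono_left atBot_le_cocompact) (hQ0.mono_left atTop_le_cocompact)
  have horth := integral_id_mul_mul_hilbert_eq_zero hg hgi (fun x => (hgb x).trans (hle1 x)) hw hw2
    hg0 hHQ'cont hH2 (hw.mul_bdd hHQ'cont.aestronglyMeasurable hH1) hHQ'
  obtain ⟨n, rfl⟩ := Nat.exists_eq_add_of_le' (one_le_two.trans hm)
  obtain ⟨s1, s2, s3⟩ := integral_pow_add_mul_integral_id_mul_deriv hQ hQbound hw 0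
  obtain ⟨r1, r2, r3⟩ := integral_pow_add_mul_integral_id_mul_deriv hQ hQbound hw n
  simp only [zero_add, pow_one, Nat.cast_zero] at s1 s2 s3
  have e1 : ∫ x, x * deriv Q x * HQ' x = -(∫ x, x * deriv Q x * Q x) +
      (∫ x, x * deriv Q x * Q x ^ (n + 1)) / (n + 1 : ℕ) := by
    rw [neg_add_eq_sub, ← integral_div, ← integral_sub (r2.div_const _) s2]
    refine integral_congr_ae (ae_of_all _ fun x => ?_)
    simp only [hHQ]
    ring
  have e2 : ∫ x, Q x * HQ' x = -(∫ x, Q x ^ 2) + (∫ x, Q x ^ (n + 2)) / (n + 1 : ℕ) := by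
    rw [neg_add_eq_sub, ← integral_div, ← integral_sub (r1.div_const _) s1]
    refine integral_congr_ae (ae_of_all _ fun x => ?_)
    simp only [hHQ]
    ring
  rw [horth] at e1
  have hn : ((n + 1 : ℕ) : ℝ) ≠ 0 := by positivity
  have e3 : (∫ x, x * deriv Q x * Q x ^ (n + 1)) = (n + 1 : ℕ) * ∫ x, x * deriv Q x * Q x := by
    field_simp at e1
    linarith
  rw [e2, r3, e3, s3]
  push_cast at hn ⊢
  field_simp
  ring
end
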